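/- arXiv:math/0310125 — 2 statements merged into one kernel-verified Lean document; each statement's English description precedes it below -/
import Mathlib

section
/- Let π be a finite set of prime numbers and let f be a field of characteristic zero generated (over its prime field ℚ) by a finite set S together with all roots of unity of degree p^n for all positive integers n and all p ∈ π. Then the set π(t(f*)) of primes p such that f* contains an element of order p is finite, the field f is regular, and f* = T × F where F is a free abelian group and T is a locally cyclic torsion group satisfying the minimal condition on subgroups (i.e., T is a locally cyclic Chernikov group). -/
/-- A field `k` is regular if it is countable and its multiplicative group is a direct
product of a torsion group and a free abelian group. -/
def IsRegularField (k : Type*) [Field k] : Prop :=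
  Countable k ∧
    ∃ T Fr : Subgroup kˣ, (∀ x ∈ T, IsOfFinOrder x) ∧ Module.Free ℤ (Additive Fr) ∧
      T ⊓ Fr = ⊥ ∧ T ⊔ Fr = ⊤

universe u v w

/-- Submodules of free modules over a principal ideal domain are free, in any rank. -/
theorem Module.Free.submodule_of_pid {R M : Type*} [CommRing R] [IsDomain R]
    [IsPrincipalIdealRing R] [AddCommGroup M] [Module R M] [Module.Free R M]
    (N : Submodule R M) : Module.Free R N := by
  classical
  let ι := Module.Free.ChooseBasisIndex R M
  let e : M ≃ₗ[R] (ι →₀ R) := (Module.Free.chooseBasis R M).repr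
  suffices h : ∀ P : Submodule R (ι →₀ R), Module.Free R P by
    have := h (N.map e.toLinearMap)
    exact Module.Free.of_equiv (e.submoduleMap N).symm
  intro P
  obtain ⟨_, _⟩ := exists_wellFoundedLT ι
  let Q : ι → Submodule R (ι →₀ R) := fun i => P ⊓ Finsupp.supported R R (Set.Iic i)
  let I : ι → Ideal R := fun i => (Q i).map (Finsupp.lapply i)
  let a : ι → R := fun i => Submodule.IsPrincipal.generator (I i)
  have ha : ∀ i, ∃ b ∈ Q i, b i = a i := fun i => Submodule.IsPrincipal.generator_mem (I i)
  choose b hbQ hba using ha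
  have hbgt : ∀ i j, i < j → b i j = 0 := fun i j hij =>
    (Finsupp.mem_supported' R (b i)).1 (hbQ i).2 j (by simpa using hij)
  let v : {i // a i ≠ 0} → P := fun i => ⟨b i, (hbQ i).1⟩
  have hspan : ∀ i, ∀ x (hx : x ∈ Q i), (⟨x, hx.1⟩ : P) ∈ Submodule.span R (Set.range v) := by
    intro i
    induction i using WellFoundedLT.induction with
    | ind i ih =>
      intro x hx
      have hlt : ∀ y (hy : y ∈ Q i), y i = 0 →
          (⟨y, hy.1⟩ : P) ∈ Submodule.span R (Set.range v) := by
        intro y hy hyi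
        by_cases h0 : y = 0
        · subst h0; exact Submodule.zero_mem _
        · have hne : y.support.Nonempty := Finsupp.support_nonempty_iff.2 h0
          have hmem := y.support.max'_mem hne
          refine ih (y.support.max' hne) ?_ y ⟨hy.1, fun j hj => y.support.le_max' j hj⟩
          refine lt_of_le_of_ne (hy.2 hmem) fun h => ?_
          rw [h] at hmem
          exact Finsupp.mem_support_iff.1 hmem hyi
      have hxi : x i ∈ I i := ⟨x, hx, rfl⟩
      obtain ⟨c, hc⟩ := (Submodule.IsPrincipal.mem_iff_eq_smul_generator (I i)).1 hxi
      have hy : x - c • b i ∈ Q i := sub_mem hx (Submodule.smul_mem _ c (hbQ i))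
      have h1 := hlt _ hy (by simp [hba, hc, a])
      by_cases hai : a i = 0
      · exact hlt x hx (by rw [hc]; change c • a i = 0; rw [hai, smul_zero])
      · have : (⟨x, hx.1⟩ : P) = ⟨x - c • b i, hy.1⟩ + c • v ⟨i, hai⟩ := by
          ext1; simp [v]
        rw [this]
        exact add_mem h1 (Submodule.smul_mem _ _ (Submodule.subset_span ⟨_, rfl⟩))
  have hli : LinearIndependent R v := by
    refine LinearIndependent.of_comp P.subtype ?_
    change LinearIndependent R (fun i : {i // a i ≠ 0} => b i)
    rw [linearIndependent_iff]
    intro l hl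
    by_contra h0
    have hne : l.support.Nonempty := Finsupp.support_nonempty_iff.2 h0
    set m := l.support.max' hne with hm
    have hmem : m ∈ l.support := l.support.max'_mem hne
    have h1 := DFunLike.congr_fun hl (m : ι)
    rw [Finsupp.linearCombination_apply, Finsupp.sum, Finsupp.finsetSum_apply,
      Finset.sum_eq_single_of_mem m hmem] at h1
    · have h2 : l m * a m = 0 := by simpa [hba] using h1
      exact (mul_ne_zero (Finsupp.mem_support_iff.1 hmem) m.2) h2
    · intro j hj hjm
      have : j < m := lt_of_le_of_ne (l.support.le_max' j hj) hjm
      simp [hbgt j m this]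
  refine Module.Free.of_basis (Module.Basis.mk hli ?_)
  rintro ⟨x, hx⟩ -
  by_cases h0 : x = 0
  · subst h0; exact Submodule.zero_mem _
  · have hne : x.support.Nonempty := Finsupp.support_nonempty_iff.2 h0
    exact hspan (x.support.max' hne) x ⟨hx, fun j hj => x.support.le_max' j hj⟩

/-- An abelian group that maps to a free abelian group with torsion kernel. -/
def FreeModTorsion (G : Type u) [AddCommGroup G] : Prop :=
  ∃ (M : Type u) (_ : AddCommGroup M) (_ : Module.Free ℤ M) (f : G →+ M),
    ∀ x, f x = 0 → IsOfFinAddOrder x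

namespace FreeModTorsion

variable {G H : Type u} [AddCommGroup G] [AddCommGroup H]

theorem of_free [Module.Free ℤ G] : FreeModTorsion G :=
  ⟨G, _, inferInstance, AddMonoidHom.id G, fun x hx => by
    rw [AddMonoidHom.id_apply] at hx; rw [hx]; exact IsOfFinAddOrder.zero⟩

theorem of_hom (h : FreeModTorsion H) (f : G →+ H)
    (hf : ∀ x, f x = 0 → IsOfFinAddOrder x) : FreeModTorsion G := by
  obtain ⟨M, _, hM, g, hg⟩ := h
  refine ⟨M, _, hM, g.comp f, fun x hx => ?_⟩
  obtain ⟨n, hn, hnx⟩ := isOfFinAddOrder_iff_nsmul_eq_zero.1 (hg _ hx)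
  rw [← map_nsmul] at hnx
  obtain ⟨m, hm, hmx⟩ := isOfFinAddOrder_iff_nsmul_eq_zero.1 (hf _ hnx)
  refine isOfFinAddOrder_iff_nsmul_eq_zero.2 ⟨m * n, Nat.mul_pos hm hn, ?_⟩
  rw [mul_nsmul', hmx]

/-- A homomorphism to a free abelian group whose kernel is free modulo torsion. -/
theorem of_ker {M : Type u} [AddCommGroup M] [Module.Free ℤ M] (φ : G →+ M) (i : H →+ G)
    (hi : Function.Injective i) (hφ : ∀ x, φ x = 0 → x ∈ i.range) (h : FreeModTorsion H) :
    FreeModTorsion G := by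
  obtain ⟨N, _, hN, g, hg⟩ := h
  have : Module.Free ℤ (LinearMap.range φ.toIntLinearMap) := .submodule_of_pid _
  let ψ : G →ₗ[ℤ] LinearMap.range φ.toIntLinearMap := φ.toIntLinearMap.rangeRestrict
  obtain ⟨s, hs⟩ := Module.projective_lifting_property ψ LinearMap.id
    (LinearMap.surjective_rangeRestrict _)
  let j := AddMonoidHom.ofInjective hi
  have key : ∀ x, x - s (ψ x) ∈ i.range := fun x => by
    refine hφ _ ?_
    have : ψ (x - s (ψ x)) = 0 := by
      rw [map_sub, sub_eq_zero]
      exact (LinearMap.congr_fun hs (ψ x)).symm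
    exact congrArg Subtype.val this
  let r : G →+ i.range :=
    (AddMonoidHom.id G - s.toAddMonoidHom.comp ψ.toAddMonoidHom).codRestrict i.range key
  refine ⟨M × N, inferInstance, inferInstance,
    φ.prod (g.comp (j.symm.toAddMonoidHom.comp r)), fun x hx => ?_⟩
  rw [AddMonoidHom.prod_apply, Prod.mk_eq_zero] at hx
  obtain ⟨h1, h2⟩ := hx
  have hψ : ψ x = 0 := Subtype.ext h1
  have h3 := hg _ h2
  have h4 : i (j.symm (r x)) = x := by
    have : j (j.symm (r x)) = r x := j.apply_symm_apply _
    have := congrArg Subtype.val this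
    change i _ = x - s (ψ x) at this
    rwa [hψ, map_zero s, sub_zero] at this
  have := i.isOfFinAddOrder h3
  exact h4 ▸ this

/-- The complement of the torsion subgroup provided by a map to a free group. -/
theorem exists_isCompl_torsion (h : FreeModTorsion G) :
    ∃ Fr : AddSubgroup G, Module.Free ℤ Fr ∧ AddCommGroup.torsion G ⊓ Fr = ⊥ ∧
      AddCommGroup.torsion G ⊔ Fr = ⊤ := by
  obtain ⟨N, _, hN, g, hg⟩ := h
  have : Module.Free ℤ (LinearMap.range g.toIntLinearMap) := .submodule_of_pid _
  let ψ : G →ₗ[ℤ] LinearMap.range g.toIntLinearMap := g.toIntLinearMap.rangeRestrict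
  obtain ⟨s, hs⟩ := Module.projective_lifting_property ψ LinearMap.id
    (LinearMap.surjective_rangeRestrict _)
  have hs' : Function.LeftInverse ψ s := LinearMap.congr_fun hs
  refine ⟨s.toAddMonoidHom.range, ?_, ?_, ?_⟩
  · exact Module.Free.of_equiv (AddMonoidHom.ofInjective (f := s.toAddMonoidHom)
      hs'.injective).toIntLinearEquiv
  · rw [eq_bot_iff]
    rintro _ ⟨hx, y, rfl⟩
    have h1 : IsOfFinAddOrder (ψ (s y)) := ψ.toAddMonoidHom.isOfFinAddOrder hx
    rw [hs' y, isOfFinAddOrder_iff_nsmul_eq_zero] at h1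
    obtain ⟨n, hn, hny⟩ := h1
    have : IsAddTorsionFree (LinearMap.range g.toIntLinearMap) := .of_isTorsionFree ℤ _
    have : y = 0 := (smul_eq_zero.1 hny).resolve_left hn.ne'
    rw [this]
    exact map_zero s
  · rw [eq_top_iff]
    intro x _
    rw [← sub_add_cancel x (s (ψ x))]
    refine AddSubgroup.add_mem_sup (hg _ ?_) ⟨_, rfl⟩
    have : ψ (x - s (ψ x)) = 0 := by rw [map_sub, hs', sub_self]
    exact congrArg Subtype.val this

/-- A torsion-free quotient by a torsion subgroup is free. -/
theorem free_of_surjective (h : FreeModTorsion G) {N : Type v} [AddCommGroup N]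
    [IsAddTorsionFree N] (q : G →+ N) (hq : Function.Surjective q)
    (hker : ∀ x, q x = 0 → IsOfFinAddOrder x) : Module.Free ℤ N := by
  obtain ⟨M, _, hM, g, hg⟩ := h
  have : IsAddTorsionFree M := .of_isTorsionFree ℤ M
  have hqg : q.ker = g.ker := by
    ext x
    simp only [AddMonoidHom.mem_ker]
    constructor
    · intro hx
      obtain ⟨n, hn, hnx⟩ := isOfFinAddOrder_iff_nsmul_eq_zero.1 (hker x hx)
      have := congrArg g hnx
      rw [map_nsmul, map_zero] at this
      exact (smul_eq_zero.1 this).resolve_left hn.ne'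
    · intro hx
      obtain ⟨n, hn, hnx⟩ := isOfFinAddOrder_iff_nsmul_eq_zero.1 (hg x hx)
      have := congrArg q hnx
      rw [map_nsmul, map_zero] at this
      exact (smul_eq_zero.1 this).resolve_left hn.ne'
  have e : g.range ≃+ N := (QuotientAddGroup.quotientKerEquivRange g).symm.trans
    ((QuotientAddGroup.quotientAddEquivOfEq hqg.symm).trans
      (QuotientAddGroup.quotientKerEquivOfSurjective q hq))
  have : Module.Free ℤ g.range :=
    Module.Free.submodule_of_pid (AddSubgroup.toIntSubmodule g.range)
  exact Module.Free.of_equiv e.toIntLinearEquiv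

end FreeModTorsion

/-- The union of a chain of submodules each of which is complemented in the next by a free
submodule is free. -/
theorem Module.Free.of_chain {R M : Type*} [Ring R] [AddCommGroup M] [Module R M]
    (P C : ℕ → Submodule R M) (h0 : P 0 = ⊥) (hinf : ∀ n, P n ⊓ C n = ⊥)
    (hsup : ∀ n, P n ⊔ C n = P (n + 1)) (htop : ∀ x, ∃ n, x ∈ P n)
    (hC : ∀ n, Module.Free R (C n)) : Module.Free R M := by
  classical
  have hmono : Monotone P := monotone_nat_of_le_succ fun n => hsup n ▸ le_sup_left
  have hCP : ∀ i n, i < n → C i ≤ P n := fun i n h =>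
    (le_sup_right.trans (hsup i).le).trans (hmono h)
  have hli : Function.Injective (DirectSum.coeLinearMap C) := by
    rw [injective_iff_map_eq_zero]
    intro f hf
    by_contra hne
    have hs : f.support.Nonempty := by
      rwa [Finset.nonempty_iff_ne_empty, Ne, DFinsupp.support_eq_empty]
    set m := f.support.max' hs
    have hm : m ∈ f.support := f.support.max'_mem hs
    rw [DirectSum.coeLinearMap_eq_dfinsuppSum, DFinsupp.sum, ← Finset.add_sum_erase _ _ hm] at hf
    have h1 : ∑ i ∈ f.support.erase m, (f i : M) ∈ P m := by
      refine Submodule.sum_mem _ fun i hi => hCP i m ?_ (f i).2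
      exact lt_of_le_of_ne (f.support.le_max' i (Finset.mem_of_mem_erase hi))
        (Finset.ne_of_mem_erase hi)
    have h2 : (f m : M) ∈ P m ⊓ C m :=
      ⟨by rw [eq_neg_of_add_eq_zero_left hf]; exact neg_mem h1, (f m).2⟩
    rw [hinf, Submodule.mem_bot] at h2
    exact DFinsupp.mem_support_iff.1 hm (Subtype.ext h2)
  have hsur : Function.Surjective (DirectSum.coeLinearMap C) := by
    rw [← LinearMap.range_eq_top, DirectSum.range_coeLinearMap, eq_top_iff]
    have : ∀ n, P n ≤ ⨆ i, C i := by
      intro n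
      induction n with
      | zero => rw [h0]; exact bot_le
      | succ n ih => rw [← hsup]; exact sup_le ih (le_iSup C n)
    intro x _
    obtain ⟨n, hn⟩ := htop x
    exact this n hn
  exact Module.Free.of_equiv (LinearEquiv.ofBijective _ ⟨hli, hsur⟩)

/-- The subgroup of elements having a nonzero multiple in a given subgroup. -/
def AddSubgroup.isolator {G : Type*} [AddCommGroup G] (A : Submodule ℤ G) : Submodule ℤ G where
  carrier := {x | ∃ n : ℤ, n ≠ 0 ∧ n • x ∈ A}
  zero_mem' := ⟨1, one_ne_zero, by simp⟩
  add_mem' := by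
    rintro x y ⟨n, hn, hx⟩ ⟨m, hm, hy⟩
    refine ⟨n * m, mul_ne_zero hn hm, ?_⟩
    rw [smul_add]
    refine add_mem ?_ ?_
    · rw [mul_comm, mul_smul]; exact A.smul_mem _ hx
    · rw [mul_smul]; exact A.smul_mem _ hy
  smul_mem' := by
    rintro c x ⟨n, hn, hx⟩
    exact ⟨n, hn, by rw [smul_comm]; exact A.smul_mem _ hx⟩

open AddSubgroup in
/-- Pontryagin's criterion: a countable torsion-free abelian group is free if the isolators of
its finitely generated subgroups are finitely generated. -/
theorem Module.Free.of_isolator_fg {G : Type*} [AddCommGroup G] [IsAddTorsionFree G]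
    [Countable G] (h : ∀ A : Submodule ℤ G, A.FG → (isolator A).FG) : Module.Free ℤ G := by
  classical
  obtain ⟨e, he⟩ := exists_surjective_nat G
  let P : ℕ → Submodule ℤ G := fun n => isolator (Submodule.span ℤ (e '' Set.Iio n))
  have hle : ∀ A : Submodule ℤ G, A ≤ isolator A := fun A x hx => ⟨1, one_ne_zero, by simpa⟩
  have hfg : ∀ n, (P n).FG := fun n =>
    h _ (Submodule.fg_span ((Set.finite_Iio n).image e))
  have hmono : ∀ n, P n ≤ P (n + 1) := by
    rintro n x ⟨k, hk, hx⟩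
    exact ⟨k, hk, Submodule.span_mono (Set.image_mono (Set.Iio_subset_Iio n.le_succ)) hx⟩
  have hC : ∀ n, ∃ C : Submodule ℤ G, P n ⊓ C = ⊥ ∧ P n ⊔ C = P (n + 1) ∧
      Module.Free ℤ C := by
    intro n
    let Q := (P (n + 1)).map (P n).mkQ
    have hQfin : Module.Finite ℤ Q := Module.Finite.iff_fg.2 ((hfg (n + 1)).map _)
    have hQtf : IsAddTorsionFree Q := by
      rw [← Module.isTorsionFree_int_iff_isAddTorsionFree]
      refine Module.IsTorsionFree.of_smul_eq_zero ?_
      rintro k ⟨_, x, hx, rfl⟩ hkx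
      by_cases hk : k = 0
      · exact Or.inl hk
      refine Or.inr (Subtype.ext ?_)
      have h1 : (P n).mkQ (k • x) = 0 := by
        rw [map_smul]; exact congrArg Subtype.val hkx
      rw [Submodule.mkQ_apply, Submodule.Quotient.mk_eq_zero] at h1
      obtain ⟨m, hm, hmx⟩ := h1
      change (P n).mkQ x = 0
      rw [Submodule.mkQ_apply, Submodule.Quotient.mk_eq_zero]
      exact ⟨m * k, mul_ne_zero hm hk, by rwa [mul_smul]⟩
    let q : P (n + 1) →ₗ[ℤ] Q := (P n).mkQ.submoduleMap (P (n + 1))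
    have hq : Function.Surjective q := (P n).mkQ.submoduleMap_surjective _
    obtain ⟨s, hs⟩ := Module.projective_lifting_property q LinearMap.id hq
    have hs' : Function.LeftInverse q s := LinearMap.congr_fun hs
    have hqv : ∀ x, ((q x : Q) : G ⧸ P n) = (P n).mkQ x := fun x => rfl
    let t : Q →ₗ[ℤ] G := (P (n + 1)).subtype ∘ₗ s
    have ht : Function.Injective t := Subtype.val_injective.comp hs'.injective
    refine ⟨LinearMap.range t, ?_, ?_, Module.Free.of_equiv (LinearEquiv.ofInjective t ht)⟩
    · rw [eq_bot_iff]
      rintro _ ⟨hx, y, rfl⟩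
      have : q (s y) = 0 := Subtype.ext (by
        rw [hqv, Submodule.mkQ_apply]; exact (Submodule.Quotient.mk_eq_zero _).2 hx)
      rw [hs'] at this
      rw [this, map_zero]
      exact zero_mem _
    · refine le_antisymm (sup_le (hmono n) ?_) ?_
      · rintro _ ⟨y, rfl⟩
        exact (s y).2
      · intro x hx
        have h1 : q ⟨x, hx⟩ = q (s (q ⟨x, hx⟩)) := (hs' _).symm
        have h2 : x - t (q ⟨x, hx⟩) ∈ P n := by
          rw [← Submodule.Quotient.mk_eq_zero, Submodule.Quotient.mk_sub, sub_eq_zero]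
          exact congrArg Subtype.val h1
        rw [← sub_add_cancel x (t (q ⟨x, hx⟩))]
        exact Submodule.add_mem_sup h2 ⟨_, rfl⟩
  choose C hC1 hC2 hC3 using hC
  refine Module.Free.of_chain P C ?_ hC1 hC2 ?_ hC3
  · rw [eq_bot_iff]
    rintro x ⟨k, hk, hx⟩
    have : k • x = 0 := by simpa using hx
    exact (smul_eq_zero.1 this).resolve_left hk
  · intro x
    obtain ⟨n, rfl⟩ := he x
    exact ⟨n + 1, hle _ (Submodule.subset_span ⟨n, n.lt_succ_self, rfl⟩)⟩

open AddSubgroup in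
/-- A countable torsion-free abelian group is free if every finite subset lies in a free subgroup
whose isolator modulo it has finite exponent. -/
theorem Module.Free.of_exists_free {G : Type*} [AddCommGroup G] [IsAddTorsionFree G] [Countable G]
    (h : ∀ s : Finset G, ∃ N : Submodule ℤ G, Module.Free ℤ N ∧ (s : Set G) ⊆ N ∧
      ∃ e : ℤ, e ≠ 0 ∧ ∀ x ∈ isolator N, e • x ∈ N) : Module.Free ℤ G := by
  refine Module.Free.of_isolator_fg ?_
  rintro _ ⟨s, rfl⟩
  obtain ⟨N, hN, hsN, e, he, heN⟩ := h s
  have hAN : Submodule.span ℤ (s : Set G) ≤ N := Submodule.span_le.2 hsN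
  let b := Module.Free.chooseBasis ℤ N
  have hfin : ((fun x : N => (x : G)) ⁻¹' (s : Set G)).Finite :=
    s.finite_toSet.preimage Subtype.val_injective.injOn
  let J : Set (Module.Free.ChooseBasisIndex ℤ N) :=
    ⋃ x ∈ (fun x : N => (x : G)) ⁻¹' (s : Set G), ((b.repr x).support : Set _)
  have hJ : J.Finite := hfin.biUnion fun x _ => (b.repr x).support.finite_toSet
  have hsJ : ∀ x, ∀ hx : x ∈ Submodule.span ℤ (s : Set G),
      b.repr ⟨x, hAN hx⟩ ∈ Finsupp.supported ℤ ℤ J := by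
    intro x hx
    induction hx using Submodule.span_induction with
    | mem x hx =>
      exact Set.subset_biUnion_of_mem (u := fun x : N =>
          ((b.repr x).support : Set (Module.Free.ChooseBasisIndex ℤ N)))
        (show (⟨x, hsN hx⟩ : N) ∈ (fun x : N => (x : G)) ⁻¹' (s : Set G) from hx)
    | zero => exact (map_zero b.repr).symm ▸ zero_mem _
    | add x y hx hy ihx ihy =>
      have := add_mem ihx ihy
      rwa [← map_add] at this
    | smul c x hx ih =>
      have := Submodule.smul_mem _ c ih
      rwa [← map_smul] at this
  have hiso : ∀ x ∈ isolator (Submodule.span ℤ (s : Set G)), x ∈ isolator N :=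
    fun x ⟨n, hn, hx⟩ => ⟨n, hn, hAN hx⟩
  let g : isolator (Submodule.span ℤ (s : Set G)) →ₗ[ℤ] Module.Free.ChooseBasisIndex ℤ N →₀ ℤ :=
    b.repr.toLinearMap ∘ₗ LinearMap.codRestrict N
      (e • (isolator (Submodule.span ℤ (s : Set G))).subtype) fun x => heN _ (hiso _ x.2)
  have hg : ∀ x, g x = b.repr ⟨e • (x : G), heN _ (hiso _ x.2)⟩ := fun x => rfl
  have hgJ : ∀ x, g x ∈ Finsupp.supported ℤ ℤ J := by
    rintro ⟨x, n, hn, hx⟩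
    have h1 := hsJ _ (Submodule.smul_mem _ e hx)
    have h2 : b.repr ⟨e • n • x, hAN (Submodule.smul_mem _ e hx)⟩ =
        n • g ⟨x, n, hn, hx⟩ := by
      rw [hg, ← map_smul]
      congr 1
      exact Subtype.ext (smul_comm _ _ _)
    rw [h2, Finsupp.mem_supported'] at h1
    rw [Finsupp.mem_supported']
    intro i hi
    exact (mul_eq_zero.1 (h1 i hi)).resolve_left hn
  have hginj : Function.Injective (g.codRestrict _ hgJ) := by
    rw [injective_iff_map_eq_zero]
    intro x hx
    have h1 : g x = 0 := congrArg Subtype.val hx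
    rw [hg] at h1
    have h2 := b.repr.map_eq_zero_iff.1 h1
    have h3 : e • (x : G) = 0 := congrArg Subtype.val h2
    exact Subtype.ext ((smul_eq_zero.1 h3).resolve_left he)
  have := hJ.to_subtype
  have hfinJ : Module.Finite ℤ (Finsupp.supported ℤ ℤ J) :=
    Module.Finite.equiv (Finsupp.supportedEquivFinsupp J).symm
  exact Module.Finite.iff_fg.1 (Module.Finite.of_injective _ hginj)

open nonZeroDivisors IsDedekindDomain FractionalIdeal in
/-- The divisor map of a Dedekind domain has the units as kernel. -/
theorem IsDedekindDomain.exists_divisor_hom (R : Type*) (K : Type u) [CommRing R]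
    [IsDedekindDomain R] [Field K] [Algebra R K] [IsFractionRing R K] :
    ∃ φ : Additive Kˣ →+ (HeightOneSpectrum R →₀ ℤ),
      ∀ x, φ x = 0 → ∃ r : Rˣ, Units.map (algebraMap R K : R →* K) r = x.toMul := by
  have hne : ∀ x : Kˣ, spanSingleton R⁰ (x : K) ≠ 0 := fun x =>
    spanSingleton_ne_zero_iff.2 x.ne_zero
  refine ⟨AddMonoidHom.mk' (fun x => Finsupp.ofSupportFinite
    (fun v => count K v (spanSingleton R⁰ (x.toMul : K)))
    (Filter.eventually_cofinite.1 (finite_factors (spanSingleton R⁰ (x.toMul : K))))) ?_, ?_⟩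
  · intro x y
    ext v
    change count K v (spanSingleton R⁰ ((x.toMul * y.toMul : Kˣ) : K)) =
      count K v (spanSingleton R⁰ (x.toMul : K)) + count K v (spanSingleton R⁰ (y.toMul : K))
    rw [← count_mul K v (hne _) (hne _), spanSingleton_mul_spanSingleton, Units.val_mul]
  · intro x hx
    have h0 : ∀ v, count K v (spanSingleton R⁰ (x.toMul : K)) = 0 := fun v =>
      DFunLike.congr_fun hx v
    have h1 : spanSingleton R⁰ (x.toMul : K) = 1 := by
      rw [← finprod_heightOneSpectrum_factorization' K (hne x.toMul)]
      simp [h0]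
    obtain ⟨a, ha⟩ := (mem_one_iff R⁰).1 (h1 ▸ mem_spanSingleton_self R⁰ (x.toMul : K))
    obtain ⟨b, hb⟩ := (mem_spanSingleton R⁰).1 (h1 ▸ (one_mem_one R⁰) :
      (1 : K) ∈ spanSingleton R⁰ (x.toMul : K))
    have hba : b * a = 1 := by
      apply IsFractionRing.injective R K
      rw [map_mul, map_one, ha, ← hb, Algebra.smul_def]
    exact ⟨⟨a, b, by rw [mul_comm, hba], hba⟩, Units.ext ha⟩

open NumberField in
/-- The units of a number field are free modulo torsion. -/
theorem NumberField.freeModTorsion (K : Type u) [Field K] [NumberField K] :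
    FreeModTorsion (Additive Kˣ) := by
  obtain ⟨φ, hφ⟩ := IsDedekindDomain.exists_divisor_hom (𝓞 K) K
  let i : (𝓞 K)ˣ →* Kˣ := Units.map (algebraMap (𝓞 K) K : 𝓞 K →* K)
  have hi : Function.Injective i := Units.map_injective (FaithfulSMul.algebraMap_injective _ _)
  refine FreeModTorsion.of_ker φ (MonoidHom.toAdditive i) hi (fun x hx => hφ x hx) ?_
  refine FreeModTorsion.of_hom
    (FreeModTorsion.of_free (G := Additive ((𝓞 K)ˣ ⧸ NumberField.Units.torsion K)))
    (MonoidHom.toAdditive (QuotientGroup.mk' (NumberField.Units.torsion K))) fun x hx => ?_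
  have h1 : x.toMul ∈ NumberField.Units.torsion K := (QuotientGroup.eq_one_iff _).1 hx
  exact (isOfFinAddOrder_ofMul_iff (x := Additive.toMul x)).2 h1

open NumberField in
/-- A number field has finitely many roots of unity. -/
theorem NumberField.finite_torsion (K : Type*) [Field K] [NumberField K] :
    {x : Kˣ | IsOfFinOrder x}.Finite := by
  have hT : Finite (NumberField.Units.torsion K) := inferInstance
  have h : (NumberField.Units.torsion K : Set (𝓞 K)ˣ).Finite := hT
  let i : (𝓞 K)ˣ →* Kˣ := Units.map (algebraMap (𝓞 K) K : 𝓞 K →* K)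
  have hi : Function.Injective i := Units.map_injective (FaithfulSMul.algebraMap_injective _ _)
  refine (h.image i).subset ?_
  intro x hx
  have hint : ∀ y : Kˣ, IsOfFinOrder y → IsIntegral ℤ (y : K) := by
    intro y hy
    obtain ⟨n, hn, hny⟩ := isOfFinOrder_iff_pow_eq_one.1 hy
    refine IsIntegral.of_pow hn ?_
    rw [← Units.val_pow_eq_pow_val, hny]
    exact isIntegral_one
  let r : (𝓞 K)ˣ :=
    ⟨⟨x, hint x hx⟩, ⟨(x⁻¹ : Kˣ), hint _ hx.inv⟩, RingOfIntegers.ext x.mul_inv,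
      RingOfIntegers.ext x.inv_mul⟩
  have hr : i r = x := Units.ext rfl
  refine ⟨r, (hi.isOfFinOrder_iff).1 ?_, hr⟩
  rw [hr]
  exact hx

/-- The unit group is free modulo torsion and has finitely many roots of unity of order prime to
`π`. -/
def HasTameUnits (π : Set ℕ) (K : Type u) [Field K] : Prop :=
  FreeModTorsion (Additive Kˣ) ∧
    {x : Kˣ | ∃ n : ℕ, n ≠ 0 ∧ (∀ p ∈ π, ¬ p ∣ n) ∧ x ^ n = 1}.Finite

open Polynomial in
theorem exists_algebraMap_eq_of_mem_adjoin_inv {k K : Type*} [Field k] [Field K] [Algebra k K]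
    {t : K} (ht : Transcendental k t) {y : K} (h : y ∈ Algebra.adjoin k {t})
    (h' : y ∈ Algebra.adjoin k {t⁻¹}) : ∃ c : k, algebraMap k K c = y := by
  have h0 : t ≠ 0 := fun h => ht (h ▸ isAlgebraic_zero)
  rw [Algebra.adjoin_singleton_eq_range_aeval] at h h'
  obtain ⟨f, rfl⟩ := h
  obtain ⟨g, hg⟩ := h'
  let _ := invertibleOfNonzero (inv_ne_zero h0)
  have h1 := eval₂_reverse_mul_pow (algebraMap k K) t⁻¹ g
  rw [invOf_eq_inv, inv_inv] at h1
  change aeval t g.reverse * _ = aeval t⁻¹ g at h1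
  have h2 : aeval t g.reverse = aeval t (f * X ^ g.natDegree) := by
    rw [map_mul, map_pow, aeval_X]
    rw [show aeval t f = aeval t⁻¹ g from hg.symm, ← h1, mul_assoc, ← mul_pow,
      inv_mul_cancel₀ h0, one_pow, mul_one]
  have h3 := transcendental_iff_injective.1 ht h2
  have h4 : f.natDegree = 0 := by
    by_cases hf : f = 0
    · simp [hf]
    have := congrArg natDegree h3
    rw [natDegree_mul_X_pow _ hf] at this
    have := g.reverse_natDegree_le
    omega
  refine ⟨f.coeff 0, ?_⟩
  conv_rhs => rw [eq_C_of_natDegree_eq_zero h4]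
  exact (aeval_C t _).symm

theorem Transcendental.isPrincipalIdealRing_adjoin {k K : Type*} [Field k] [Field K] [Algebra k K]
    {t : K} (ht : Transcendental k t) : IsPrincipalIdealRing (Algebra.adjoin k {t}) :=
  IsPrincipalIdealRing.of_surjective (Polynomial.algEquivOfTranscendental k t ht)
    (Polynomial.algEquivOfTranscendental k t ht).surjective

open IntermediateField algebraAdjoinAdjoin in
/-- An element integral over `k[t]` and over `k[t⁻¹]` is algebraic over `k`. -/
theorem isAlgebraic_of_isIntegral_adjoin_inv {k K : Type*} [Field k] [Field K] [Algebra k K]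
    {t : K} (ht : Transcendental k t) {x : K}
    (h : IsIntegral (Algebra.adjoin k {t}) x) (h' : IsIntegral (Algebra.adjoin k {t⁻¹}) x) :
    IsAlgebraic k x := by
  have key : ∀ s : K, Transcendental k s → IsIntegral (Algebra.adjoin k {s}) x →
      (minpoly (Algebra.adjoin k {s}) x).map (algebraMap _ K) = (minpoly k⟮s⟯ x).map
        (algebraMap _ K) := by
    intro s hs hx
    have := hs.isPrincipalIdealRing_adjoin
    rw [minpoly.isIntegrallyClosed_eq_field_fractions' k⟮s⟯ hx, Polynomial.map_map,
      ← IsScalarTower.algebraMap_eq]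
  have ht' : Transcendental k t⁻¹ := fun h => ht (by simpa using h.inv)
  have heq : k⟮t⁻¹⟯ = k⟮t⟯ := by
    apply le_antisymm <;> rw [adjoin_simple_le_iff]
    · exact inv_mem (mem_adjoin_simple_self k t)
    · simpa using inv_mem (mem_adjoin_simple_self k t⁻¹)
  have hE : ∀ E : IntermediateField k K, E = k⟮t⟯ → (minpoly E x).map (algebraMap E K) =
      (minpoly k⟮t⟯ x).map (algebraMap k⟮t⟯ K) := by
    rintro E rfl; rfl
  have h1 := key t ht h
  have h2 := (key t⁻¹ ht' h').trans (hE _ heq)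
  have hl : (minpoly (Algebra.adjoin k {t}) x).map (algebraMap _ K) ∈
      Polynomial.lifts (algebraMap k K) := by
    rw [Polynomial.lifts_iff_coeff_lifts]
    intro n
    refine exists_algebraMap_eq_of_mem_adjoin_inv ht ?_ ?_
    · rw [Polynomial.coeff_map]
      exact Subtype.property _
    · rw [h1, ← h2, Polynomial.coeff_map]
      exact Subtype.property _
  obtain ⟨q, hq, -, hqm⟩ := Polynomial.lifts_and_natDegree_eq_and_monic hl
    ((minpoly.monic h).map _)
  refine ⟨q, hqm.ne_zero, ?_⟩
  rw [Polynomial.aeval_def, Polynomial.eval₂_eq_eval_map, hq, Polynomial.eval_map_algebraMap,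
    minpoly.aeval]

open IntermediateField algebraAdjoinAdjoin in
theorem Transcendental.exists_divisor_hom {k : Type v} {K : Type u} [Field k] [CharZero k]
    [Field K] [Algebra k K] {t : K} (ht : Transcendental k t) [FiniteDimensional k⟮t⟯ K] :
    ∃ (M : Type u) (_ : AddCommGroup M) (_ : Module.Free ℤ M) (φ : Additive Kˣ →+ M),
      ∀ x, φ x = 0 → IsIntegral (Algebra.adjoin k {t}) (x.toMul : K) := by
  have := ht.isPrincipalIdealRing_adjoin
  have := integralClosure.isDedekindDomain (Algebra.adjoin k {t}) k⟮t⟯ K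
  have := integralClosure.isFractionRing_of_finite_extension (A := Algebra.adjoin k {t}) k⟮t⟯ K
  obtain ⟨φ, hφ⟩ := IsDedekindDomain.exists_divisor_hom
    (integralClosure (Algebra.adjoin k {t}) K) K
  refine ⟨_, _, inferInstance, φ, fun x hx => ?_⟩
  obtain ⟨r, hr⟩ := hφ x hx
  rw [← hr]
  exact r.val.property

open IntermediateField algebraAdjoinAdjoin in
/-- The field of constants of a function field embeds into a finite extension of the base field. -/
theorem Transcendental.exists_residue_field {k : Type v} {K : Type u} [Field k] [CharZero k]
    [Field K] [Algebra k K] {t : K} (ht : Transcendental k t) [FiniteDimensional k⟮t⟯ K] :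
    ∃ (L : Type u) (_ : Field L) (_ : Algebra k L) (_ : FiniteDimensional k L),
      Nonempty (algebraicClosure k K →+* L) := by
  have := ht.isPrincipalIdealRing_adjoin
  let A := Algebra.adjoin k {t}
  let B := integralClosure A K
  have : Module.Finite A B := IsIntegralClosure.finite A k⟮t⟯ K B
  have : Algebra.FiniteType k A := Subalgebra.fg_iff_finiteType _ |>.1 ⟨{t}, by simp [A]⟩
  have : IsScalarTower k A B := inferInstance
  have : Algebra.FiniteType k B := Algebra.FiniteType.trans (S := A) inferInstance inferInstance
  obtain ⟨P, hP⟩ := Ideal.exists_maximal B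
  let _ := Ideal.Quotient.field P
  have := finite_of_finite_type_of_isJacobsonRing k (B ⧸ P)
  let j : algebraicClosure k K →+* B :=
    { toFun := fun x => ⟨x, ?_⟩
      map_one' := rfl
      map_mul' := fun _ _ => rfl
      map_zero' := rfl
      map_add' := fun _ _ => rfl }
  · exact ⟨B ⧸ P, _, inferInstance, this, ⟨(Ideal.Quotient.mk P).comp j⟩⟩
  · have : IsIntegral k (x : K) := isAlgebraic_iff_isIntegral.1 (mem_algebraicClosure_iff.1 x.2)
    exact this.tower_top

open IntermediateField in
theorem HasTameUnits.of_transcendental {π : Set ℕ} {k : Type v} {K : Type u} [Field k] [CharZero k]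
    [Field K] [Algebra k K] {t : K} (ht : Transcendental k t) [FiniteDimensional k⟮t⟯ K]
    (h : ∀ (L : Type u) [Field L] [Algebra k L] [FiniteDimensional k L], HasTameUnits π L) :
    HasTameUnits π K := by
  have ht' : Transcendental k t⁻¹ := fun h => ht (by simpa using h.inv)
  have heq : k⟮t⟯ = k⟮t⁻¹⟯ := by
    apply le_antisymm <;> rw [adjoin_simple_le_iff]
    · simpa using inv_mem (mem_adjoin_simple_self k t⁻¹)
    · exact inv_mem (mem_adjoin_simple_self k t)
  have : FiniteDimensional k⟮t⁻¹⟯ K := heq ▸ ‹FiniteDimensional k⟮t⟯ K›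
  obtain ⟨L, _, _, _, ⟨j⟩⟩ := ht.exists_residue_field
  obtain ⟨hL, hfin⟩ := h L
  obtain ⟨M, _, _, φ, hφ⟩ := ht.exists_divisor_hom
  obtain ⟨M', _, _, φ', hφ'⟩ := ht'.exists_divisor_hom
  let C := algebraicClosure k K
  let i : Cˣ →* Kˣ := Units.map (algebraMap C K : C →* K)
  have hi : Function.Injective i := Units.map_injective (algebraMap C K).injective
  have hrange : ∀ x : Kˣ, IsAlgebraic k (x : K) → ∃ y, i y = x := by
    intro x hx
    have hx0 : (⟨x, mem_algebraicClosure_iff.2 hx⟩ : C) ≠ 0 := fun h0 =>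
      x.ne_zero (congrArg Subtype.val h0)
    exact ⟨Units.mk0 _ hx0, Units.ext rfl⟩
  let r : Cˣ →* Lˣ := Units.map (j : C →* L)
  have hr : Function.Injective r := Units.map_injective j.injective
  refine ⟨FreeModTorsion.of_ker (φ.prod φ') (MonoidHom.toAdditive i) hi (fun x hx => ?_)
    (FreeModTorsion.of_hom hL (MonoidHom.toAdditive r) fun x hx => ?_), ?_⟩
  · have h1 : φ x = 0 := congrArg Prod.fst hx
    have h2 : φ' x = 0 := congrArg Prod.snd hx
    exact hrange x.toMul (isAlgebraic_of_isIntegral_adjoin_inv ht (hφ x h1) (hφ' x h2))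
  · rw [(injective_iff_map_eq_zero (MonoidHom.toAdditive r)).1 hr x hx]
    exact IsOfFinAddOrder.zero
  · refine ((hfin.preimage hr.injOn).image i).subset ?_
    rintro x ⟨n, hn, hnπ, hx⟩
    have halg : IsAlgebraic k (x : K) := by
      refine (IsIntegral.of_pow (Nat.pos_of_ne_zero hn) ?_).isAlgebraic
      rw [← Units.val_pow_eq_pow_val, hx]
      exact isIntegral_one
    obtain ⟨y, rfl⟩ := hrange x halg
    refine ⟨y, ⟨n, hn, hnπ, ?_⟩, rfl⟩
    rw [← map_pow, show y ^ n = 1 from hi (by rw [map_pow, hx, map_one]), map_one]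

/-- In an abelian extension `L/K` such that the roots of unity of `K` have exponent dividing `w`,
the group `Lˣ / (Kˣ · μ(L))` has torsion of exponent dividing `w`. -/
theorem IsAbelianGalois.pow_mem_range_sup_torsion {K L : Type*} [Field K] [Field L] [Algebra K L]
    [IsAbelianGalois K L] {w : ℕ} (hw : ∀ ζ : Kˣ, IsOfFinOrder ζ → ζ ^ w = 1) {x : Lˣ} {n : ℕ}
    (hn : n ≠ 0)
    (hx : x ^ n ∈ (Units.map (algebraMap K L : K →* L)).range ⊔ CommGroup.torsion Lˣ) :
    x ^ w ∈ (Units.map (algebraMap K L : K →* L)).range ⊔ CommGroup.torsion Lˣ := by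
  set i : Kˣ →* Lˣ := Units.map (algebraMap K L : K →* L) with hi_def
  have hi : Function.Injective i := Units.map_injective (algebraMap K L).injective
  set H : Subgroup Lˣ := i.range ⊔ CommGroup.torsion Lˣ with hH
  let s : Gal(L/K) → Lˣ →* Lˣ := fun σ => Units.map (σ : L →* L)
  have hs : ∀ σ c, s σ (i c) = i c := fun σ c => Units.ext (σ.commutes _)
  have hcomm : ∀ σ τ y, s τ (s σ y) = s σ (s τ y) := fun σ τ y =>
    Units.ext (DFunLike.congr_fun (mul_comm' τ σ) (y : L))
  have hfix : ∀ y : Lˣ, (∀ σ, s σ y = y) → y ∈ i.range := by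
    intro y hy
    obtain ⟨c, hc⟩ := (InfiniteGalois.mem_range_algebraMap_iff_fixed (y : L)).2
      fun σ => congrArg Units.val (hy σ)
    have hc0 : c ≠ 0 := by
      rintro rfl
      exact y.ne_zero (by rw [← hc, map_zero])
    exact ⟨Units.mk0 c hc0, Units.ext hc⟩
  obtain ⟨m, hm, hxm⟩ : ∃ m ≠ 0, x ^ m ∈ i.range := by
    obtain ⟨a, ha, t, ht, hat⟩ := Subgroup.mem_sup.1 hx
    obtain ⟨r, hr, htr⟩ := isOfFinOrder_iff_pow_eq_one.1 ht
    refine ⟨n * r, mul_ne_zero hn hr.ne', ?_⟩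
    rw [pow_mul, ← hat, mul_pow, htr, mul_one]
    exact pow_mem ha r
  have : NeZero m := ⟨hm⟩
  obtain ⟨ζ₀, hζ₀⟩ := IsCyclic.exists_generator (α := rootsOfUnity m L)
  obtain ⟨ζ, hζ⟩ := ζ₀
  have hgen : ∀ η : Lˣ, η ^ m = 1 → ∃ j : ℤ, ζ ^ j = η := by
    intro η hη
    obtain ⟨j, hj⟩ := hζ₀ ⟨η, hη⟩
    exact ⟨j, by simpa using congrArg Subtype.val hj⟩
  have hdiv : ∀ σ, ∃ j : ℤ, s σ x = ζ ^ j * x := by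
    intro σ
    obtain ⟨c, hc⟩ := hxm
    obtain ⟨j, hj⟩ := hgen (s σ x / x) (by
      rw [div_pow, ← map_pow, ← hc, hs, div_self'])
    exact ⟨j, by rw [hj, div_mul_cancel]⟩
  have hζfin : IsOfFinOrder ζ := isOfFinOrder_iff_pow_eq_one.2 ⟨m, Nat.pos_of_ne_zero hm, hζ⟩
  have hζT : ∀ j : ℤ, ζ ^ j ∈ H := fun j =>
    Subgroup.mem_sup_right (zpow_mem (show ζ ∈ CommGroup.torsion Lˣ from hζfin) j)
  let g := orderOf (x : Lˣ ⧸ H)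
  have hg : ∀ j : ℤ, x ^ j ∈ H → (g : ℤ) ∣ j := by
    intro j hj
    rw [orderOf_dvd_iff_zpow_eq_one, ← QuotientGroup.mk_zpow]
    exact (QuotientGroup.eq_one_iff _).2 hj
  have hgN : g ∣ orderOf ζ := by
    rw [← Int.natCast_dvd_natCast]
    refine hg _ (Subgroup.mem_sup_left (hfix _ fun σ => ?_))
    obtain ⟨j, hj⟩ := hdiv σ
    rw [map_zpow, hj, mul_zpow, zpow_natCast, zpow_natCast, ← zpow_natCast, zpow_comm,
      zpow_natCast, pow_orderOf_eq_one, one_zpow, one_mul]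
  have hact : ∀ σ, ∃ e : ℤ, s σ ζ = ζ ^ e ∧ (g : ℤ) ∣ e - 1 := by
    intro σ
    obtain ⟨e, he⟩ := hgen (s σ ζ) (by rw [← map_pow, show ζ ^ m = 1 from hζ, map_one])
    refine ⟨e, he.symm, hg _ ?_⟩
    obtain ⟨j, hj⟩ := hdiv σ
    have hy : x ^ e / s σ x ∈ i.range := hfix _ fun τ => by
      obtain ⟨l, hl⟩ := hdiv τ
      rw [map_div, map_zpow, hcomm, hl, map_mul, map_zpow, ← he, mul_zpow, ← zpow_mul, ← zpow_mul,
        mul_comm e l, mul_div_mul_left_eq_div]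
    have : x ^ (e - 1) = (x ^ e / s σ x) * ζ ^ j := by
      rw [hj, zpow_sub_one, div_eq_mul_inv, mul_inv_rev, ← mul_assoc, inv_mul_cancel_right]
    rw [this]
    exact mul_mem (Subgroup.mem_sup_left hy) (hζT j)
  obtain ⟨N', hN'⟩ := hgN
  have hζ' : ζ ^ N' ∈ i.range := hfix _ fun σ => by
    obtain ⟨e, he, d, hd⟩ := hact σ
    rw [map_pow, he, show e = g * d + 1 by omega, zpow_add_one, mul_pow, ← zpow_natCast (_ ^ _),
      ← zpow_mul, show (g : ℤ) * d * N' = ((g * N' : ℕ) : ℤ) * d by push_cast; ring, ← hN',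
      zpow_mul, zpow_natCast, pow_orderOf_eq_one, one_zpow, one_mul]
  obtain ⟨c, hc⟩ := hζ'
  have hcw : c ^ w = 1 := hw c (hi.isOfFinOrder_iff.1 (by rw [hc]; exact hζfin.pow))
  have h1 : orderOf ζ ∣ N' * w := by
    rw [orderOf_dvd_iff_pow_eq_one, pow_mul, ← hc, ← map_pow, hcw, map_one]
  have hN0 : 0 < N' := Nat.pos_of_ne_zero fun h0 =>
    hζfin.orderOf_pos.ne' (by rw [hN', h0, mul_zero])
  have h2 : g ∣ w := by
    rw [hN', mul_comm] at h1
    exact Nat.dvd_of_mul_dvd_mul_left hN0 h1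
  rw [← QuotientGroup.eq_one_iff, QuotientGroup.mk_pow]
  exact orderOf_dvd_iff_pow_eq_one.1 h2

/-- A countable field has units free modulo torsion if each of its finite subsets lies in a subfield
with finitely many roots of unity and units free modulo torsion over which it is abelian. -/
theorem FreeModTorsion.units_of_isAbelianGalois {L : Type u} [Field L] [Countable L]
    (h : ∀ s : Finset L, ∃ (K : Type u) (_ : Field K) (_ : Algebra K L), IsAbelianGalois K L ∧
      (s : Set L) ⊆ Set.range (algebraMap K L) ∧ FreeModTorsion (Additive Kˣ) ∧
        {x : Kˣ | IsOfFinOrder x}.Finite) : FreeModTorsion (Additive Lˣ) := by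
  classical
  let q : Lˣ →* Lˣ ⧸ CommGroup.torsion Lˣ := QuotientGroup.mk' _
  have hq : Function.Surjective q := QuotientGroup.mk'_surjective _
  have hq1 : ∀ x, q x = 1 ↔ IsOfFinOrder x := fun x => QuotientGroup.eq_one_iff x
  have : Countable Lˣ := Units.val_injective.countable
  have : Countable (Additive (Lˣ ⧸ CommGroup.torsion Lˣ)) := hq.countable
  suffices hfree : Module.Free ℤ (Additive (Lˣ ⧸ CommGroup.torsion Lˣ)) from
    FreeModTorsion.of_hom (FreeModTorsion.of_free (G := Additive (Lˣ ⧸ CommGroup.torsion Lˣ)))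
      (MonoidHom.toAdditive q) fun x hx => (hq1 x.toMul).1 hx
  refine Module.Free.of_exists_free fun s => ?_
  choose σ hσ using hq
  obtain ⟨K, _, _, _, hs, hK, hfin⟩ := h (s.image fun x => (σ x.toMul : L))
  let i : Kˣ →* Lˣ := Units.map (algebraMap K L : K →* L)
  have hi : Function.Injective i := Units.map_injective (algebraMap K L).injective
  let N := (MonoidHom.toAdditive (q.comp i)).range
  have hNfree : Module.Free ℤ N := hK.free_of_surjective
    (MonoidHom.toAdditive (q.comp i)).rangeRestrict
    (MonoidHom.toAdditive (q.comp i)).rangeRestrict_surjective fun x hx =>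
      hi.isOfFinOrder_iff.1 ((hq1 (i x.toMul)).1 (congrArg Subtype.val hx))
  have : Finite (CommGroup.torsion Kˣ) := hfin
  refine ⟨AddSubgroup.toIntSubmodule N, hNfree, fun x hx => ?_, Nat.card (CommGroup.torsion Kˣ),
    Nat.cast_ne_zero.2 Nat.card_pos.ne', fun x hx => ?_⟩
  · obtain ⟨c, hc⟩ := hs (Finset.mem_coe.2 (Finset.mem_image_of_mem _ hx))
    have hc0 : c ≠ 0 := by
      rintro rfl
      exact (σ x.toMul).ne_zero (by rw [← hc, map_zero])
    refine ⟨Additive.ofMul (Units.mk0 c hc0), ?_⟩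
    have : i (Units.mk0 c hc0) = σ x.toMul := Units.ext hc
    exact (congrArg q this).trans (hσ _)
  · obtain ⟨n, hn, c, hc⟩ := hx
    obtain ⟨y, rfl⟩ : ∃ y, Additive.ofMul (q y) = x := ⟨_, hσ x.toMul⟩
    have hmem : ∀ z : Lˣ, q z ∈ (q.comp i).range ↔ z ∈ i.range ⊔ CommGroup.torsion Lˣ := by
      intro z
      rw [MonoidHom.range_comp, ← Subgroup.mem_comap, Subgroup.comap_map_eq, QuotientGroup.ker_mk']
    have h1 : y ^ n.natAbs ∈ i.range ⊔ CommGroup.torsion Lˣ := by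
      have : y ^ n ∈ i.range ⊔ CommGroup.torsion Lˣ := (hmem _).1 ⟨c.toMul, by
        rw [map_zpow]; exact hc⟩
      rcases Int.natAbs_eq n with h | h <;> rw [h] at this
      · exact_mod_cast this
      · rw [zpow_neg, inv_mem_iff] at this
        exact_mod_cast this
    have h2 := (hmem _).2 (IsAbelianGalois.pow_mem_range_sup_torsion
      (w := Nat.card (CommGroup.torsion Kˣ)) (fun ζ hζ => congrArg Subtype.val
        (pow_card_eq_one' (x := (⟨ζ, hζ⟩ : CommGroup.torsion Kˣ)))) (Int.natAbs_ne_zero.2 hn) h1)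
    obtain ⟨d, hd⟩ := h2
    refine ⟨Additive.ofMul d, ?_⟩
    rw [map_pow] at hd
    exact hd.trans (natCast_zsmul (Additive.ofMul (q y)) _).symm

open IntermediateField in
/-- A primitive `m`-th root of unity has degree at least `φ m` over a cyclotomic field generated by
roots of unity of order prime to `m`. -/
theorem totient_le_natDegree_minpoly_of_coprime {L : Type*} [Field L] [CharZero L]
    {m : ℕ} {x : L} (hx : IsPrimitiveRoot x m) (hm : m ≠ 0)
    {E : IntermediateField ℚ L}
    (hE : ∀ c ∈ E, ∃ N : ℕ, N ≠ 0 ∧ N.Coprime m ∧ c ∈ adjoin ℚ {z : L | z ^ N = 1})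
    (hint : IsIntegral E x) : m.totient ≤ (minpoly E x).natDegree := by
  have hfin : ∀ {n : ℕ} {z : L}, IsPrimitiveRoot z n → n ≠ 0 →
      IsIntegral ℚ z ∧ Module.finrank ℚ ℚ⟮z⟯ = n.totient := by
    intro n z hz hn
    have : NeZero n := ⟨hn⟩
    have hint := hz.isIntegral (Nat.pos_of_ne_zero hn) |>.tower_top (A := ℚ)
    refine ⟨hint, ?_⟩
    rw [adjoin.finrank hint, ← Polynomial.cyclotomic_eq_minpoly_rat hz (Nat.pos_of_ne_zero hn),
      Polynomial.natDegree_cyclotomic]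
  set P := (minpoly E x).map (algebraMap E L) with hP
  have hcoeff : ∀ i, ∃ N : ℕ, N ≠ 0 ∧ N.Coprime m ∧ P.coeff i ∈ adjoin ℚ {z : L | z ^ N = 1} := by
    intro i
    refine hE _ ?_
    rw [hP, Polynomial.coeff_map]
    exact Subtype.property _
  choose N hN0 hNm hN using hcoeff
  set n := ∏ i ∈ Finset.range (P.natDegree + 1), N i with hn
  have hn0 : n ≠ 0 := Finset.prod_ne_zero_iff.2 fun i _ => hN0 i
  have hnm : n.Coprime m := Nat.Coprime.prod_left fun i _ => hNm i
  have : NeZero n := ⟨hn0⟩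
  obtain ⟨η, hη⟩ := IsCyclic.exists_generator (α := rootsOfUnity n L)
  set n' := orderOf ((η : Lˣ) : L) with hn'
  have hηroot : IsPrimitiveRoot ((η : Lˣ) : L) n' := IsPrimitiveRoot.orderOf _
  have hn'n : n' ∣ n := orderOf_dvd_of_pow_eq_one ((mem_rootsOfUnity' n _).1 η.2)
  have hn'0 : n' ≠ 0 := fun h => hn0 (Nat.eq_zero_of_zero_dvd (h ▸ hn'n))
  have hmem : ∀ z : L, z ^ n = 1 → z ∈ ℚ⟮((η : Lˣ) : L)⟯ := by
    intro z hz
    obtain ⟨j, hj⟩ := hη (rootsOfUnity.mkOfPowEq z hz)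
    have := congrArg (fun y : rootsOfUnity n L => ((y : Lˣ) : L)) hj
    simp only [rootsOfUnity.coe_mkOfPowEq, Subgroup.coe_zpow, Units.val_zpow_eq_zpow_val] at this
    rw [← this]
    exact zpow_mem (mem_adjoin_simple_self ℚ _) j
  set E₀ := ℚ⟮((η : Lˣ) : L)⟯ with hE₀
  have hl : P ∈ Polynomial.lifts (algebraMap E₀ L) := by
    rw [Polynomial.lifts_iff_coeff_lifts]
    intro i
    by_cases hi : i ∈ Finset.range (P.natDegree + 1)
    · refine ⟨⟨P.coeff i, ?_⟩, rfl⟩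
      refine adjoin_le_iff.2 ?_ (hN i)
      intro z hz
      obtain ⟨c, hc⟩ := Finset.dvd_prod_of_mem N hi
      exact hmem z (by rw [hn, hc, pow_mul, show z ^ N i = 1 from hz, one_pow])
    · refine ⟨0, ?_⟩
      rw [map_zero, Polynomial.coeff_eq_zero_of_natDegree_lt]
      simpa using hi
  obtain ⟨Q, hQ, hQdeg, hQm⟩ := Polynomial.lifts_and_natDegree_eq_and_monic hl
    ((minpoly.monic hint).map _)
  have hQx : Polynomial.aeval x Q = 0 := by
    rw [Polynomial.aeval_def, Polynomial.eval₂_eq_eval_map, hQ, Polynomial.eval_map_algebraMap,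
      minpoly.aeval]
  have hdeg : (minpoly E₀ x).natDegree ≤ (minpoly E x).natDegree := by
    rw [← Polynomial.natDegree_map (algebraMap E L), ← hP, ← hQdeg]
    exact Polynomial.natDegree_le_of_dvd (minpoly.dvd _ _ hQx) hQm.ne_zero
  have hprim : IsPrimitiveRoot ((η : Lˣ) * x : L) (n' * m) := by
    have hmx : orderOf x = m := hx.eq_orderOf.symm
    have := (Commute.all ((η : Lˣ) : L) x).orderOf_mul_eq_mul_orderOf_of_coprime
      (by rw [← hn', hmx]; exact hnm.coprime_dvd_left hn'n)
    rw [← hn', hmx] at this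
    rw [← this]
    exact IsPrimitiveRoot.orderOf _
  have hx₀ : IsIntegral E₀ x := ⟨Q, hQm, hQx⟩
  have : FiniteDimensional ℚ E₀ := adjoin.finiteDimensional (hfin hηroot hn'0).1
  have : FiniteDimensional E₀ E₀⟮x⟯ := adjoin.finiteDimensional hx₀
  have : FiniteDimensional ℚ E₀⟮x⟯ := FiniteDimensional.trans ℚ E₀ E₀⟮x⟯
  have hle : ℚ⟮((η : Lˣ) * x : L)⟯ ≤ E₀⟮x⟯.restrictScalars ℚ := by
    rw [adjoin_simple_le_iff]
    exact mul_mem (IntermediateField.algebraMap_mem E₀⟮x⟯ (⟨_, mem_adjoin_simple_self ℚ _⟩ : E₀))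
      (mem_adjoin_simple_self E₀ x)
  have h1 : Module.finrank ℚ ℚ⟮((η : Lˣ) * x : L)⟯ ≤ Module.finrank ℚ E₀⟮x⟯ :=
    have : Module.Finite ℚ (E₀⟮x⟯.restrictScalars ℚ) := ‹FiniteDimensional ℚ E₀⟮x⟯›
    LinearMap.finrank_le_finrank_of_injective (f := (inclusion hle).toLinearMap)
      (inclusion hle).injective
  have : Module.Free E₀ E₀⟮x⟯ := Module.Free.of_divisionRing _ _
  rw [(hfin hprim (mul_ne_zero hn'0 hm)).2, ← Module.finrank_mul_finrank ℚ E₀ E₀⟮x⟯,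
    (hfin hηroot hn'0).2, adjoin.finrank hx₀,
    Nat.totient_mul (hnm.coprime_dvd_left hn'n)] at h1
  exact (Nat.le_of_mul_le_mul_left h1 (Nat.totient_pos.2 (Nat.pos_of_ne_zero hn'0))).trans hdeg

/-- Every `m` divides the factorial of `2 φ(m)`. -/
theorem Nat.dvd_factorial_two_mul_totient {m d : ℕ} (hm : m ≠ 0) (h : m.totient ≤ d) :
    m ∣ (2 * d).factorial := by
  rw [Nat.dvd_iff_prime_pow_dvd_dvd]
  intro p k hp hk
  refine Nat.dvd_factorial (pow_pos hp.pos k) ?_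
  have h1 : (p ^ k).totient ≤ d :=
    (Nat.le_of_dvd (Nat.totient_pos.2 (Nat.pos_of_ne_zero hm)) (Nat.totient_dvd_of_dvd hk)).trans h
  have hd : 1 ≤ d := (Nat.totient_pos.2 (Nat.pos_of_ne_zero hm)).trans_le h
  rcases k with _ | k
  · rw [pow_zero]; omega
  · rw [Nat.totient_prime_pow_succ hp] at h1
    have h2 : p ≤ 2 * (p - 1) := by have := hp.two_le; omega
    calc p ^ (k + 1) = p ^ k * p := pow_succ _ _
      _ ≤ p ^ k * (2 * (p - 1)) := Nat.mul_le_mul_left _ h2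
      _ = 2 * (p ^ k * (p - 1)) := by ring
      _ ≤ 2 * d := Nat.mul_le_mul_left _ h1

open IntermediateField in
/-- A finite extension of the field generated by all roots of unity of `p`-power order for `p ∈ π`
has tame units. -/
theorem HasTameUnits.of_adjoin_roots {π : Set ℕ} (hπ : ∀ p ∈ π, p.Prime) {L : Type u} [Field L]
    [CharZero L] (hroots : ∀ p ∈ π, ∀ n : ℕ, 0 < n → ∃ ζ : L, IsPrimitiveRoot ζ (p ^ n))
    {b : Set L} (hbfin : b.Finite) (hb : ∀ x ∈ b, IsIntegral ℚ x)
    (hgen : adjoin ℚ ({x : L | ∃ p ∈ π, ∃ n : ℕ, 0 < n ∧ x ^ p ^ n = 1} ∪ b) = ⊤) :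
    HasTameUnits π L := by
  set Z : Set L := {x : L | ∃ p ∈ π, ∃ n : ℕ, 0 < n ∧ x ^ p ^ n = 1} with hZ
  have hZint : ∀ x ∈ Z, IsIntegral ℚ x := by
    rintro x ⟨p, hp, n, -, hx⟩
    exact IsIntegral.of_pow (pow_pos (hπ p hp).pos n) (hx ▸ isIntegral_one)
  have halg : Algebra.IsAlgebraic ℚ L := by
    have h := isAlgebraic_adjoin (K := ℚ) (S := Z ∪ b) fun x hx => hx.elim (hZint x) (hb x)
    rw [hgen] at h
    exact (topEquiv (F := ℚ) (E := L)).isAlgebraic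
  have hcount : Countable L := by
    have h := Algebraic.countable ℚ L
    rwa [show {x : L | IsAlgebraic ℚ x} = Set.univ from
      Set.eq_univ_of_forall Algebra.IsAlgebraic.isAlgebraic, Set.countable_univ_iff] at h
  constructor
  · refine FreeModTorsion.units_of_isAbelianGalois fun s => ?_
    let K := adjoin ℚ ((s : Set L) ∪ b)
    have : Finite ((s : Set L) ∪ b : Set L) := s.finite_toSet.union hbfin
    have : FiniteDimensional ℚ K := finiteDimensional_adjoin fun x _ =>
      (Algebra.IsAlgebraic.isAlgebraic x).isIntegral
    have : NumberField K := ⟨⟩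
    refine ⟨K, inferInstance, inferInstance, ?_, ?_, NumberField.freeModTorsion K,
      NumberField.finite_torsion K⟩
    · have : IsCyclotomicExtension {n | ∃ p ∈ π, ∃ k, 0 < k ∧ n = p ^ k} K L := by
        refine ⟨?_, fun x => ?_⟩
        · rintro _ ⟨p, hp, k, hk, rfl⟩ -
          exact hroots p hp k hk
        · set R := {b : L | ∃ n ∈ {n | ∃ p ∈ π, ∃ k, 0 < k ∧ n = p ^ k}, n ≠ 0 ∧ b ^ n = 1}
          rw [← adjoin_toSubalgebra_of_isAlgebraic fun y _ =>
            (Algebra.IsAlgebraic.isAlgebraic (R := ℚ) y).tower_top K]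
          have hle : adjoin ℚ (Z ∪ b) ≤ (adjoin K R).restrictScalars ℚ := by
            rw [adjoin_le_iff]
            rintro y (⟨p, hp, n, hn, hy⟩ | hy)
            · exact subset_adjoin K R ⟨p ^ n, ⟨p, hp, n, hn, rfl⟩,
                (pow_pos (hπ p hp).pos n).ne', hy⟩
            · exact (adjoin K R).algebraMap_mem ⟨y, subset_adjoin ℚ _ (Or.inr hy)⟩
          rw [hgen] at hle
          exact hle (mem_top (x := x))
      exact IsCyclotomicExtension.isAbelianGalois {n | ∃ p ∈ π, ∃ k, 0 < k ∧ n = p ^ k} K L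
    · exact fun x hx => ⟨⟨x, subset_adjoin ℚ _ (Or.inl hx)⟩, rfl⟩
  · let E := adjoin ℚ Z
    have hEb : adjoin E b = ⊤ := by
      have hle : adjoin ℚ (Z ∪ b) ≤ (adjoin E b).restrictScalars ℚ := by
        rw [adjoin_le_iff]
        rintro y (hy | hy)
        · exact (adjoin E b).algebraMap_mem ⟨y, subset_adjoin ℚ _ hy⟩
        · exact subset_adjoin E b hy
      rw [hgen] at hle
      exact top_le_iff.1 fun x _ => hle (mem_top (x := x))
    have : Finite b := hbfin
    have : FiniteDimensional E (adjoin E b) := finiteDimensional_adjoin fun x hx =>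
      (hb x hx).tower_top
    rw [hEb] at this
    have : FiniteDimensional E L := (topEquiv (F := E) (E := L)).toLinearEquiv.finiteDimensional
    have hfin :
        ((rootsOfUnity (2 * Module.finrank E L).factorial L : Subgroup Lˣ) : Set Lˣ).Finite :=
      have : NeZero (2 * Module.finrank E L).factorial := ⟨Nat.factorial_ne_zero _⟩
      (inferInstance : Finite (rootsOfUnity _ L))
    refine hfin.subset ?_
    rintro x ⟨n, hn, hnπ, hx⟩
    have hroot : IsPrimitiveRoot (x : L) (orderOf x) :=
      IsPrimitiveRoot.coe_units_iff.2 (IsPrimitiveRoot.orderOf x)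
    have hdvd : orderOf x ∣ n := orderOf_dvd_of_pow_eq_one hx
    have h0 : orderOf x ≠ 0 := fun h => hn (Nat.eq_zero_of_zero_dvd (h ▸ hdvd))
    have hE : ∀ c ∈ E, ∃ N : ℕ, N ≠ 0 ∧ N.Coprime (orderOf x) ∧
        c ∈ adjoin ℚ {z : L | z ^ N = 1} := by
      have hmono : ∀ {N N' : ℕ}, N ∣ N' →
          adjoin ℚ {z : L | z ^ N = 1} ≤ adjoin ℚ {z : L | z ^ N' = 1} := by
        rintro N _ ⟨d, rfl⟩
        refine adjoin.mono _ _ _ fun z hz => ?_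
        rw [Set.mem_ofPred_eq] at hz ⊢
        rw [pow_mul, hz, one_pow]
      intro c hc
      induction hc using adjoin_induction with
      | mem z hz =>
        obtain ⟨p, hp, k, hk, hz⟩ := hz
        exact ⟨p ^ k, (pow_pos (hπ p hp).pos k).ne', (((hπ p hp).coprime_iff_not_dvd.2
          (hnπ p hp)).coprime_dvd_right hdvd).pow_left k, subset_adjoin ℚ _ hz⟩
      | algebraMap q =>
        exact ⟨1, one_ne_zero, Nat.coprime_one_left _, IntermediateField.algebraMap_mem _ q⟩
      | add y z _ _ hy hz =>
        obtain ⟨N, hN, hNx, hy⟩ := hy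
        obtain ⟨N', hN', hNx', hz⟩ := hz
        exact ⟨N * N', mul_ne_zero hN hN', hNx.mul_left hNx',
          add_mem (hmono (dvd_mul_right _ _) hy) (hmono (dvd_mul_left _ _) hz)⟩
      | inv y _ hy =>
        obtain ⟨N, hN, hNx, hy⟩ := hy
        exact ⟨N, hN, hNx, inv_mem hy⟩
      | mul y z _ _ hy hz =>
        obtain ⟨N, hN, hNx, hy⟩ := hy
        obtain ⟨N', hN', hNx', hz⟩ := hz
        exact ⟨N * N', mul_ne_zero hN hN', hNx.mul_left hNx',
          mul_mem (hmono (dvd_mul_right _ _) hy) (hmono (dvd_mul_left _ _) hz)⟩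
    have hle := (totient_le_natDegree_minpoly_of_coprime hroot h0 hE
      (IsIntegral.of_finite E (x : L))).trans (minpoly.natDegree_le (x : L))
    exact orderOf_dvd_iff_pow_eq_one.1 (Nat.dvd_factorial_two_mul_totient h0 hle)

open IntermediateField in
/-- The image of `k(S)` in an extension field `L` lies in the field generated over `k` by the image
of `S`. -/
theorem IntermediateField.algebraMap_mem_adjoin_image {k F L : Type*} [Field k] [Field F]
    [Field L] [Algebra k F] [Algebra k L] (S : Set F) [Algebra (adjoin k S) L]
    [IsScalarTower k (adjoin k S) L] (y : adjoin k S) :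
    algebraMap (adjoin k S) L y ∈
      adjoin k {z : L | ∃ x : adjoin k S, (x : F) ∈ S ∧ algebraMap (adjoin k S) L x = z} := by
  obtain ⟨y, hy⟩ := y
  induction hy using adjoin_induction with
  | mem x hx => exact subset_adjoin k _ ⟨⟨x, subset_adjoin k S hx⟩, hx, rfl⟩
  | algebraMap c =>
    have := IsScalarTower.algebraMap_apply k (adjoin k S) L c
    exact this ▸ IntermediateField.algebraMap_mem _ c
  | add x y hxS hyS hx hy =>
    have := map_add (algebraMap (adjoin k S) L) ⟨x, hxS⟩ ⟨y, hyS⟩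
    exact Set.mem_of_eq_of_mem this (add_mem hx hy)
  | inv x hxS hx =>
    have := map_inv₀ (algebraMap (adjoin k S) L) ⟨x, hxS⟩
    exact Set.mem_of_eq_of_mem this (inv_mem hx)
  | mul x y hxS hyS hx hy =>
    have := map_mul (algebraMap (adjoin k S) L) ⟨x, hxS⟩ ⟨y, hyS⟩
    exact Set.mem_of_eq_of_mem this (mul_mem hx hy)

open IntermediateField in
theorem HasTameUnits.of_adjoin_simple {π : Set ℕ} {k : Type v} {F : Type w} [Field k] [CharZero k]
    [Field F] [Algebra k F] (x : F)
    (h : ∀ (L : Type u) [Field L] [Algebra k L] [FiniteDimensional k L], HasTameUnits π L)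
    (L : Type u) [Field L] [Algebra k⟮x⟯ L] [FiniteDimensional k⟮x⟯ L] : HasTameUnits π L := by
  let _ : Algebra k L := ((algebraMap k⟮x⟯ L).comp (algebraMap k k⟮x⟯)).toAlgebra
  have : IsScalarTower k k⟮x⟯ L := .of_algebraMap_eq' rfl
  by_cases hx : IsAlgebraic k x
  · have := adjoin.finiteDimensional hx.isIntegral
    have := FiniteDimensional.trans k k⟮x⟯ L
    exact h L
  · set t := algebraMap k⟮x⟯ L (AdjoinSimple.gen k x) with ht_def
    have ht : Transcendental k t := by
      intro h
      have h1 := (isAlgebraic_algebraMap_iff (algebraMap k⟮x⟯ L).injective).1 h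
      exact hx (h1.algebraMap (A := F))
    have hmem : ∀ y : k⟮x⟯, algebraMap k⟮x⟯ L y ∈ k⟮t⟯ := by
      intro y
      convert algebraMap_mem_adjoin_image (L := L) {x} y
      ext z
      constructor
      · rintro rfl
        exact ⟨AdjoinSimple.gen k x, rfl, rfl⟩
      · rintro ⟨y, hy, rfl⟩
        exact congrArg _ (Subtype.ext hy)
    let _ : Algebra k⟮x⟯ k⟮t⟯ := ((algebraMap k⟮x⟯ L).codRestrict k⟮t⟯ hmem).toAlgebra
    have : IsScalarTower k⟮x⟯ k⟮t⟯ L := .of_algebraMap_eq' rfl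
    have : FiniteDimensional k⟮t⟯ L := Module.Finite.of_restrictScalars_finite k⟮x⟯ k⟮t⟯ L
    exact HasTameUnits.of_transcendental ht h

open IntermediateField in
/-- A finitely generated extension of the field generated by all roots of unity of `p`-power order
for `p ∈ π` has tame units. -/
theorem HasTameUnits.of_finitelyGenerated {π : Set ℕ} (hπ : ∀ p ∈ π, p.Prime) {F : Type u}
    [Field F] [CharZero F]
    (hroots : ∀ p ∈ π, ∀ n : ℕ, 0 < n → ∃ ζ : F, IsPrimitiveRoot ζ (p ^ n))
    {S : Set F} (hS : S.Finite)
    (hgen : adjoin ℚ (S ∪ {x : F | ∃ p ∈ π, ∃ n : ℕ, 0 < n ∧ x ^ p ^ n = 1}) = ⊤) :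
    HasTameUnits π F := by
  set Z : Set F := {x : F | ∃ p ∈ π, ∃ n : ℕ, 0 < n ∧ x ^ p ^ n = 1} with hZ
  let E := adjoin ℚ Z
  have hZint : ∀ x ∈ Z, IsIntegral ℚ x := by
    rintro x ⟨p, hp, n, -, hx⟩
    exact IsIntegral.of_pow (pow_pos (hπ p hp).pos n) (hx ▸ isIntegral_one)
  have hE : Algebra.IsAlgebraic ℚ E := isAlgebraic_adjoin hZint
  have hbase : ∀ (L : Type u) [Field L] [Algebra E L] [FiniteDimensional E L],
      HasTameUnits π L := by
    intro L _ _ _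
    have : CharZero L := charZero_of_injective_algebraMap (algebraMap E L).injective
    have : Algebra.IsAlgebraic ℚ L := .trans ℚ E L
    let B := Module.finBasis E L
    refine HasTameUnits.of_adjoin_roots hπ ?_ (Set.finite_range B)
      (fun x _ => (Algebra.IsAlgebraic.isAlgebraic x).isIntegral) ?_
    · intro p hp n hn
      obtain ⟨ζ, hζ⟩ := hroots p hp n hn
      have hmem : ζ ∈ E := subset_adjoin ℚ Z ⟨p, hp, n, hn, hζ.pow_eq_one⟩
      have hζE : IsPrimitiveRoot (⟨ζ, hmem⟩ : E) (p ^ n) :=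
        IsPrimitiveRoot.of_map_of_injective (f := E.val) hζ E.val.injective
      exact ⟨_, hζE.map_of_injective (algebraMap E L).injective⟩
    · have hEL : ∀ y : E, algebraMap E L y ∈
          adjoin ℚ ({x : L | ∃ p ∈ π, ∃ n : ℕ, 0 < n ∧ x ^ p ^ n = 1} ∪ Set.range B) := by
        intro y
        refine adjoin.mono ℚ _ _ ?_ (algebraMap_mem_adjoin_image (L := L) Z y)
        rintro _ ⟨x, ⟨p, hp, n, hn, hx⟩, rfl⟩
        refine Or.inl ⟨p, hp, n, hn, ?_⟩
        rw [← map_pow, show x ^ p ^ n = 1 from Subtype.ext hx, map_one]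
      refine top_le_iff.1 fun y _ => ?_
      rw [← B.sum_repr y]
      refine sum_mem fun i _ => ?_
      rw [Algebra.smul_def]
      exact mul_mem (hEL _) (subset_adjoin ℚ _ (Or.inr ⟨i, rfl⟩))
  have htop : adjoin E (hS.toFinset : Set F) = ⊤ := by
    have hle : adjoin ℚ (S ∪ Z) ≤ (adjoin E (hS.toFinset : Set F)).restrictScalars ℚ := by
      rw [adjoin_le_iff, hS.coe_toFinset]
      rintro y (hy | hy)
      · exact subset_adjoin E S hy
      · exact (adjoin E S).algebraMap_mem ⟨y, subset_adjoin ℚ _ hy⟩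
    rw [hgen] at hle
    exact top_le_iff.1 fun x _ => hle (mem_top (x := x))
  have hind := induction_on_adjoin_finset (F := E) (E := F) hS.toFinset
    (fun K => ∀ (L : Type u) [Field L] [Algebra K L] [FiniteDimensional K L], HasTameUnits π L)
    (by
      intro L _ _ _
      let _ : Algebra E L := ((algebraMap (⊥ : IntermediateField E F) L).comp
        (algebraMap E (⊥ : IntermediateField E F))).toAlgebra
      have : IsScalarTower E (⊥ : IntermediateField E F) L := .of_algebraMap_eq' rfl
      have : FiniteDimensional E L := FiniteDimensional.trans E (⊥ : IntermediateField E F) L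
      exact hbase L)
    (by
      intro K x _ hK L _ hA hfin
      let _ : Algebra K⟮x⟯ L := hA
      have : FiniteDimensional K⟮x⟯ L := hfin
      exact HasTameUnits.of_adjoin_simple x hK L)
  rw [htop] at hind
  have : FiniteDimensional (⊤ : IntermediateField E F) F :=
    Module.Finite.of_surjective (Algebra.linearMap (⊤ : IntermediateField E F) F)
      (topEquiv (F := E) (E := F)).surjective
  exact hind F

theorem IntermediateField.countable_of_adjoin_eq_top {k K : Type*} [Field k] [Field K] [Algebra k K]
    [Countable k] {S : Set K} (hS : S.Countable) (h : IntermediateField.adjoin k S = ⊤) :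
    Countable K := by
  have h1 := IntermediateField.lift_cardinalMk_adjoin_le k S
  rw [h] at h1
  have h2 : Cardinal.mk (⊤ : IntermediateField k K) ≤ Cardinal.aleph0 := by
    rw [← Cardinal.lift_le_aleph0]
    refine h1.trans ?_
    simp [hS]
  have : Countable (⊤ : IntermediateField k K) := Cardinal.mk_le_aleph0_iff.1 h2
  exact (IntermediateField.topEquiv (F := k) (E := K)).symm.injective.countable

/-- A torsion group of units of a field is locally cyclic. -/
theorem Subgroup.isCyclic_of_fg_of_isOfFinOrder_units {F : Type*} [Field F] {T : Subgroup Fˣ}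
    (hT : ∀ x ∈ T, IsOfFinOrder x) {H : Subgroup T} (hH : H.FG) : IsCyclic H := by
  have : Group.FG H := (Group.fg_iff_subgroup_fg H).2 hH
  have hH' : IsMulTorsion H := fun x =>
    Submonoid.isOfFinOrder_coe.1 (Submonoid.isOfFinOrder_coe.1 (hT _ (x : T).2))
  have : Finite H := CommGroup.finite_of_fg_isMulTorsion H hH'
  exact isCyclic_of_injective_ringHom (R := F) ((Units.coeHom F).comp (T.subtype.comp H.subtype))
    (Units.val_injective.comp (Subtype.val_injective.comp Subtype.val_injective))

/-- A torsion group of units of a field has the minimal condition on subgroups if only finitely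
many primes are orders of units. -/
theorem Subgroup.wellFoundedLT_of_finite_primes {F : Type*} [Field F] {T : Subgroup Fˣ}
    (hT : ∀ x ∈ T, IsOfFinOrder x) (hP : {p : ℕ | p.Prime ∧ ∃ x : Fˣ, orderOf x = p}.Finite) :
    WellFoundedLT (Subgroup T) := by
  set P := {p : ℕ | p.Prime ∧ ∃ x : Fˣ, orderOf x = p} with hPdef
  have : Finite P := hP
  let Φ : Subgroup T → P → ℕ∞ := fun H p =>
    ⨆ n : {n : ℕ // ∃ x ∈ H, orderOf x = (p : ℕ) ^ n}, ((n : ℕ) : ℕ∞)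
  have hmono : Monotone Φ := fun H H' hle p =>
    iSup_le fun ⟨n, x, hx, hn⟩ => le_iSup
      (fun n : {n : ℕ // ∃ x ∈ H', orderOf x = (p : ℕ) ^ n} => ((n : ℕ) : ℕ∞)) ⟨n, x, hle hx, hn⟩
  have hmem : ∀ H H' : Subgroup T, Φ H' ≤ Φ H → ∀ m : ℕ, 0 < m → ∀ x ∈ H', orderOf x = m →
      x ∈ H := by
    intro H H' hle m
    induction m using Nat.recOnPosPrimePosCoprime with
    | prime_pow p n hp hn =>
      intro _ x hx hxo
      have hpP : p ∈ P := by
        refine ⟨hp, (x ^ p ^ (n - 1) : T), ?_⟩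
        rw [Subgroup.orderOf_coe, orderOf_pow_of_dvd (pow_pos hp.pos _).ne'
          (hxo ▸ pow_dvd_pow p (n.sub_le 1)), hxo, Nat.pow_div (n.sub_le 1) hp.pos,
          Nat.sub_sub_self hn, pow_one]
      have h1 : ((n - 1 : ℕ) : ℕ∞) < Φ H ⟨p, hpP⟩ := by
        refine lt_of_lt_of_le (Nat.cast_lt.2 (Nat.sub_lt hn one_pos)) (le_trans ?_ (hle ⟨p, hpP⟩))
        exact le_iSup (fun n : {n : ℕ // ∃ x ∈ H', orderOf x = p ^ n} => ((n : ℕ) : ℕ∞))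
          ⟨n, x, hx, hxo⟩
      obtain ⟨⟨n', y, hy, hyo⟩, hn'⟩ := lt_iSup_iff.1 h1
      have hnn' : n ≤ n' := by
        have : n - 1 < n' := Nat.cast_lt.1 hn'
        omega
      have : NeZero (p ^ n') := ⟨(pow_pos hp.pos _).ne'⟩
      have hprim : IsPrimitiveRoot ((y : Fˣ) : F) (p ^ n') := by
        rw [← hyo, ← Subgroup.orderOf_coe, ← orderOf_units]
        exact IsPrimitiveRoot.orderOf _
      have hpow : ((x : Fˣ) : F) ^ p ^ n' = 1 := by
        have : x ^ p ^ n' = 1 := orderOf_dvd_iff_pow_eq_one.1 (hxo ▸ pow_dvd_pow p hnn')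
        simpa using congrArg (fun z : T => ((z : Fˣ) : F)) this
      obtain ⟨i, -, hi⟩ := hprim.eq_pow_of_pow_eq_one hpow
      have : y ^ i = x := Subtype.ext (Units.ext (by exact_mod_cast hi))
      exact this ▸ pow_mem hy i
    | zero => exact fun h => absurd h (lt_irrefl 0)
    | one =>
      intro _ x _ hx
      exact orderOf_eq_one_iff.1 hx ▸ one_mem H
    | coprime a b ha hb hab iha ihb =>
      intro _ x hx hxo
      have hxa := ihb (by omega) (x ^ a) (pow_mem hx a) (by
        rw [orderOf_pow_of_dvd (by omega) (hxo ▸ dvd_mul_right a b), hxo,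
          Nat.mul_div_cancel_left _ (by omega)])
      have hxb := iha (by omega) (x ^ b) (pow_mem hx b) (by
        rw [orderOf_pow_of_dvd (by omega) (hxo ▸ dvd_mul_left b a), hxo,
          Nat.mul_div_cancel _ (by omega)])
      have hbez := Nat.gcd_eq_gcd_ab a b
      rw [hab, Nat.cast_one] at hbez
      have : x = (x ^ a) ^ a.gcdA b * (x ^ b) ^ a.gcdB b := by
        rw [← zpow_natCast, ← zpow_natCast, ← zpow_mul, ← zpow_mul, ← zpow_add, ← hbez, zpow_one]
      rw [this]
      exact mul_mem (zpow_mem hxa _) (zpow_mem hxb _)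
  have hstrict : StrictMono Φ := fun H H' hlt => lt_of_le_not_ge (hmono hlt.le) fun hle =>
    hlt.not_ge fun x hx => hmem H H' hle (orderOf x)
      (orderOf_pos_iff.2 (Submonoid.isOfFinOrder_coe.1 (hT _ x.2))) x hx rfl
  exact hstrict.wellFoundedLT

/-- The torsion subgroup of a group that is free modulo torsion has a free complement. -/
theorem FreeModTorsion.exists_isCompl_torsion_units {G : Type u} [CommGroup G]
    (h : FreeModTorsion (Additive G)) : ∃ Fr : Subgroup G, Module.Free ℤ (Additive Fr) ∧
      CommGroup.torsion G ⊓ Fr = ⊥ ∧ CommGroup.torsion G ⊔ Fr = ⊤ := by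
  obtain ⟨Fr, hfree, hinf, hsup⟩ := h.exists_isCompl_torsion
  have htors : AddSubgroup.toSubgroup' (AddCommGroup.torsion (Additive G)) =
      CommGroup.torsion G := by
    ext x
    exact isOfFinAddOrder_ofMul_iff (x := x)
  refine ⟨AddSubgroup.toSubgroup' Fr, hfree, ?_, ?_⟩
  · rw [← htors, ← map_inf, hinf, map_bot]
  · rw [← htors, ← map_sup, hsup, map_top]

/-- If only finitely many roots of unity in a field have order prime to the finite set `π`, then
only finitely many primes are orders of roots of unity. -/
theorem HasTameUnits.finite_primes {π : Set ℕ} (hπfin : π.Finite) (hπ : ∀ p ∈ π, p.Prime)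
    {F : Type u} [Field F] (h : HasTameUnits π F) :
    {p : ℕ | p.Prime ∧ ∃ x : Fˣ, orderOf x = p}.Finite := by
  refine (hπfin.union (h.2.image orderOf)).subset ?_
  rintro p ⟨hp, x, rfl⟩
  refine or_iff_not_imp_left.2 fun hxπ => ⟨x, ⟨orderOf x, hp.ne_zero, fun q hq hdvd => ?_,
    pow_orderOf_eq_one x⟩, rfl⟩
  exact hxπ ((Nat.prime_dvd_prime_iff_eq (hπ q hq) hp).1 hdvd ▸ hq)

/-- Proposition 2.3(ii): a field of characteristic zero generated by a
finite set together with all `p^n`-th roots of unity for `p` in a finite set `π` of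
primes has finite `π(t(f*))`, is regular, and `f* = T × F` with `T` a locally cyclic
torsion group with the minimal condition on subgroups and `F` free abelian. -/
theorem units_of_field_generated_by_finite_set_and_roots_of_unity
    (F : Type*) [Field F] (π : Set ℕ) (hπfin : π.Finite) (hπ : ∀ p ∈ π, p.Prime)
    [CharZero F]
    -- F contains all the required roots of unity
    (hroots : ∀ p ∈ π, ∀ n : ℕ, 0 < n → ∃ ζ : F, IsPrimitiveRoot ζ (p ^ n))
    -- F is generated over ℚ by a finite set S together with all those roots of unity
    (S : Set F) (hS : S.Finite)
    (hgen : IntermediateField.adjoin ℚ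
      (S ∪ {x : F | ∃ p ∈ π, ∃ n : ℕ, 0 < n ∧ x ^ p ^ n = 1}) = ⊤) :
    {p : ℕ | p.Prime ∧ ∃ x : Fˣ, orderOf x = p}.Finite ∧
    IsRegularField F ∧
    ∃ T Fr : Subgroup Fˣ,
      (∀ x ∈ T, IsOfFinOrder x) ∧
      (∀ H : Subgroup T, H.FG → IsCyclic H) ∧
      WellFoundedLT (Subgroup T) ∧
      Module.Free ℤ (Additive Fr) ∧
      T ⊓ Fr = ⊥ ∧ T ⊔ Fr = ⊤ := by
  have htame := HasTameUnits.of_finitelyGenerated hπ hroots hS hgen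
  have hprimes := htame.finite_primes hπfin hπ
  obtain ⟨Fr, hfree, hinf, hsup⟩ := htame.1.exists_isCompl_torsion_units
  have hT : ∀ x ∈ CommGroup.torsion Fˣ, IsOfFinOrder x := fun x hx => hx
  have hZ : {x : F | ∃ p ∈ π, ∃ n : ℕ, 0 < n ∧ x ^ p ^ n = 1}.Countable := by
    have hfin : ∀ p ∈ π, ∀ n : ℕ, {x : F | x ^ p ^ n = 1}.Finite := fun p hp n => by
      have hpos := pow_pos (hπ p hp).pos n
      refine (Polynomial.nthRootsFinset (p ^ n) (1 : F)).finite_toSet.subset fun x hx => ?_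
      exact (Polynomial.mem_nthRootsFinset hpos 1).2 hx
    refine (hπfin.countable.biUnion fun p hp =>
      Set.countable_iUnion fun n => (hfin p hp n).countable).mono ?_
    rintro x ⟨p, hp, n, -, hx⟩
    exact Set.mem_biUnion hp (Set.mem_iUnion.2 ⟨n, hx⟩)
  exact ⟨hprimes,
    ⟨IntermediateField.countable_of_adjoin_eq_top (hS.countable.union hZ) hgen,
      CommGroup.torsion Fˣ, Fr, hT, hfree, hinf, hsup⟩,
    CommGroup.torsion Fˣ, Fr, hT, fun _ hH => Subgroup.isCyclic_of_fg_of_isOfFinOrder_units hT hH,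
    Subgroup.wellFoundedLT_of_finite_primes hT hprimes, hfree, hinf, hsup⟩
end

section
/- Let k be a finitely generated field of characteristic zero and let G be an abelian group of finite rank whose torsion subgroup t(G) is Chernikov. Then every faithful irreducible representation of G over k is induced from a representation of some finitely generated subgroup of G; that is, if M is a simple kG-module whose annihilator P = Ann_{kG}(M) satisfies G ∩ (1 + P) = 1, then there exist a finitely generated subgroup H ≤ G and a kH-submodule U of M such that M ≅ U ⊗_{kH} kG. -/
/-- Scalar multiplication by a fixed element of a commutative `k`-algebra `A` acting on an
`A`-module `M`, viewed as a `k`-linear endomorphism of `M`. -/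
def smulLinearMap (k : Type*) {A M : Type*} [CommSemiring k] [CommSemiring A] [Algebra k A]
    [AddCommMonoid M] [Module A M] [Module k M] [IsScalarTower k A M] (c : A) : M →ₗ[k] M where
  toFun m := c • m
  map_add' := smul_add c
  map_smul' a m := (smul_comm a c m).symm

theorem CommGroup.subgroup_fg_iff_toIntSubmodule {G : Type*} [CommGroup G] (H : Subgroup G) :
    H.FG ↔ (AddSubgroup.toIntSubmodule (Subgroup.toAddSubgroup H)).FG := by
  rw [Subgroup.fg_iff_add_fg, Submodule.fg_iff_addSubgroup_fg,
    AddSubgroup.toIntSubmodule_toAddSubgroup]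

theorem Subgroup.FG.of_map_of_inf_ker {G N : Type*} [CommGroup G] [CommGroup N] {H : Subgroup G}
    (f : G →* N) (h₁ : (H.map f).FG) (h₂ : (H ⊓ f.ker).FG) : H.FG := by
  rw [CommGroup.subgroup_fg_iff_toIntSubmodule] at *
  exact Submodule.fg_of_fg_map_of_fg_inf_ker f.toAdditive.toIntLinearMap h₁ h₂

theorem Subgroup.FG.of_le {G : Type*} [CommGroup G] {H K : Subgroup G} (hK : K.FG) (h : H ≤ K) :
    H.FG := by
  rw [CommGroup.subgroup_fg_iff_toIntSubmodule] at *
  have : IsNoetherian ℤ (AddSubgroup.toIntSubmodule (Subgroup.toAddSubgroup K)) :=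
    isNoetherian_of_fg_of_noetherian _ hK
  exact Submodule.FG.of_le hK h

theorem Subgroup.FG.comap_of_injective {G N : Type*} [CommGroup G] [CommGroup N] {K : Subgroup N}
    (hK : K.FG) (f : G →* N) (hf : Function.Injective f) : (K.comap f).FG := by
  refine .of_map_of_inf_ker f (hK.of_le (Subgroup.map_comap_le f K)) ?_
  rw [(MonoidHom.ker_eq_bot_iff f).2 hf, inf_bot_eq]
  exact .bot

theorem Subgroup.FG.map {G N : Type*} [Group G] [Group N] {H : Subgroup G}
    (hH : H.FG) (f : G →* N) : (H.map f).FG := by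
  classical
  obtain ⟨S, rfl⟩ := hH
  exact ⟨S.image f, by rw [MonoidHom.map_closure, Finset.coe_image]⟩

theorem Subgroup.fg_of_commGroup_fg {G : Type*} [CommGroup G] [Group.FG G] (H : Subgroup G) :
    H.FG :=
  (Group.fg_def.1 ‹_›).of_le le_top

/-- Every group of units of `L` that is torsion modulo a finitely generated group is finitely
generated. -/
def Field.RootClosuresFG (L : Type*) [Field L] : Prop :=
  ∀ A Γ : Subgroup Lˣ, A.FG → (∀ γ ∈ Γ, ∃ n : ℕ, 0 < n ∧ γ ^ n ∈ A) → Γ.FG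

open IsDedekindDomain in
/-- The group of units of a Dedekind domain, inside its fraction field, determines finite
generation of groups that are torsion modulo a finitely generated group. -/
theorem Subgroup.FG.of_inf_units_dedekind (R : Type*) {L : Type*} [CommRing R] [IsDedekindDomain R]
    [Field L] [Algebra R L] [IsFractionRing R L] {A Γ : Subgroup Lˣ} (hA : A.FG)
    (hΓ : ∀ γ ∈ Γ, ∃ n : ℕ, 0 < n ∧ γ ^ n ∈ A)
    (h : (Γ ⊓ (Units.map (algebraMap R L : R →* L)).range).FG) : Γ.FG := by
  obtain ⟨S, rfl⟩ := hA
  set T : Set (HeightOneSpectrum R) := ⋃ a ∈ S,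
    (HeightOneSpectrum.Support R (a : L) ∪ HeightOneSpectrum.Support R ((a⁻¹ : Lˣ) : L)) with hT
  have hTfin : T.Finite := S.finite_toSet.biUnion fun a _ ↦
    (HeightOneSpectrum.Support.finite _ _).union (HeightOneSpectrum.Support.finite _ _)
  have := hTfin.to_subtype
  let val (v : HeightOneSpectrum R) : Lˣ →* ((WithZero (Multiplicative ℤ))ˣ) :=
    Units.map (v.valuation L : L →* WithZero (Multiplicative ℤ))
  have hval (v) (hv : v ∉ T) (γ) (hγ : γ ∈ Γ) : val v γ = 1 := by
    have hSv : Subgroup.closure (S : Set Lˣ) ≤ (val v).ker := by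
      rw [Subgroup.closure_le]
      intro a ha
      simp only [hT, Set.mem_iUnion, not_exists, Set.mem_union, not_or,
        HeightOneSpectrum.Support, Set.mem_ofPred_eq, not_lt] at hv
      obtain ⟨h1, h2⟩ := hv a ha
      rw [SetLike.mem_coe, MonoidHom.mem_ker, Units.ext_iff]
      refine le_antisymm h1 ?_
      rw [Units.val_inv_eq_inv_val, map_inv₀] at h2
      exact (inv_le_one₀ (by simp [zero_lt_iff])).1 h2
    obtain ⟨n, hn, hγn⟩ := hΓ γ hγ
    have := hSv hγn
    rw [MonoidHom.mem_ker, map_pow] at this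
    rw [Units.ext_iff, Units.val_pow_eq_pow_val, Units.val_one] at this
    exact Units.ext ((pow_eq_one_iff.1 this).resolve_right hn.ne')
  have hfg : Group.FG (WithZero (Multiplicative ℤ))ˣ :=
    Group.fg_of_surjective (f := (WithZero.unitsWithZeroEquiv
      (α := Multiplicative ℤ)).symm.toMonoidHom) (MulEquiv.surjective _)
  let f : Lˣ →* (T → (WithZero (Multiplicative ℤ))ˣ) := MonoidHom.pi fun v ↦ val v
  refine .of_map_of_inf_ker f (Subgroup.fg_of_commGroup_fg _) (h.of_le ?_)
  rintro γ ⟨hγ, hγ'⟩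
  refine ⟨hγ, ?_⟩
  have hv1 (v : HeightOneSpectrum R) : val v γ = 1 := by
    by_cases hv : v ∈ T
    · exact congr_fun (MonoidHom.mem_ker.1 hγ') ⟨v, hv⟩
    · exact hval v hv γ hγ
  have key (u : Lˣ) (hu : ∀ v, val v u = 1) : ∃ r : R, algebraMap R L r = u :=
    HeightOneSpectrum.mem_integers_of_valuation_le_one L (u : L)
      fun v ↦ (Units.ext_iff.1 (hu v)).le
  obtain ⟨r, hr⟩ := key γ hv1
  obtain ⟨s, hs⟩ := key γ⁻¹ fun v ↦ by rw [map_inv, hv1, inv_one]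
  have hrs : r * s = 1 := IsFractionRing.injective R L (by simp [hr, hs])
  exact ⟨⟨r, s, hrs, by rw [mul_comm, hrs]⟩, Units.ext hr⟩

theorem NumberField.rootClosuresFG (L : Type*) [Field L] [NumberField L] :
    Field.RootClosuresFG L := by
  intro A Γ hA hΓ
  refine .of_inf_units_dedekind (NumberField.RingOfIntegers L) hA hΓ (.of_le ?_ inf_le_right)
  have : Group.FG (NumberField.RingOfIntegers L)ˣ := Group.fg_iff_monoid_fg.2 inferInstance
  rw [← Group.fg_iff_subgroup_fg]
  infer_instance

universe v

open IntermediateField algebraAdjoinAdjoin in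
theorem Transcendental.isDedekindDomain_integralClosure_adjoin {K E : Type*} [Field K] [Field E]
    [Algebra K E] [CharZero K] {x : E} (hx : Transcendental K x) [FiniteDimensional K⟮x⟯ E] :
    IsDedekindDomain (integralClosure (Algebra.adjoin K {x}) E) := by
  have : IsPrincipalIdealRing (Algebra.adjoin K {x}) :=
    .of_surjective (Polynomial.algEquivOfTranscendental K x hx).toAlgHom
      (Polynomial.algEquivOfTranscendental K x hx).surjective
  have : CharZero K⟮x⟯ := charZero_of_injective_algebraMap (algebraMap K K⟮x⟯).injective
  exact integralClosure.isDedekindDomain (Algebra.adjoin K {x}) K⟮x⟯ E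

open IntermediateField algebraAdjoinAdjoin in
theorem Transcendental.isFractionRing_integralClosure_adjoin {K E : Type*} [Field K] [Field E]
    [Algebra K E] (x : E) [FiniteDimensional K⟮x⟯ E] :
    IsFractionRing (integralClosure (Algebra.adjoin K {x}) E) E :=
  integralClosure.isFractionRing_of_finite_extension K⟮x⟯ E

/-- An element integral over both `K[x]` and `K[x⁻¹]` is algebraic over `K`. -/
theorem isAlgebraic_of_isIntegral_adjoin_of_isIntegral_adjoin_inv {K E : Type*} [Field K] [Field E]
    [Algebra K E] {x y : E} (h₁ : IsIntegral (Algebra.adjoin K {x}) y)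
    (h₂ : IsIntegral (Algebra.adjoin K {x⁻¹}) y) : IsAlgebraic K y := by
  have key (V : ValuationSubring E) (hV : Set.range (algebraMap K E) ⊆ V.toSubring) (z : E)
      (hz : z ∈ V) (hy : IsIntegral (Algebra.adjoin K {z}) y) : y ∈ V := by
    have hle : (Algebra.adjoin K {z}).toSubring ≤ V.toSubring := by
      rw [Algebra.adjoin_eq_ring_closure, Subring.closure_le]
      exact Set.union_subset hV (Set.singleton_subset_iff.2 hz)
    have h := IsIntegrallyClosedIn.isIntegral_iff (R := V) (A := E) (x := y) |>.1
      (by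
        obtain ⟨p, hp, hpy⟩ := hy
        refine ⟨p.map (Subring.inclusion hle), hp.map _, ?_⟩
        rw [Polynomial.eval₂_map]
        exact hpy)
    obtain ⟨v, rfl⟩ := h
    exact v.2
  have hmem : y ∈ (⨅ V : {V : ValuationSubring E // Set.range (algebraMap K E) ⊆ V.toSubring},
      V.1.toSubring) := by
    rw [Subring.mem_iInf]
    rintro ⟨V, hV⟩
    rcases V.mem_or_inv_mem x with h | h
    · exact key V hV x h h₁
    · exact key V hV _ h h₂
  rw [iInf_valuationSubring_superset] at hmem
  obtain ⟨p, hp, hpy⟩ : IsIntegral (Subring.closure (Set.range (algebraMap K E))) y := hmem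
  have hle : Subring.closure (Set.range (algebraMap K E)) ≤ (algebraMap K E).range :=
    Subring.closure_le.2 (by simp)
  have hy : IsIntegral (algebraMap K E).range y :=
    ⟨p.map (Subring.inclusion hle), hp.map _, by rw [Polynomial.eval₂_map]; exact hpy⟩
  obtain ⟨q, hq⟩ := Polynomial.map_surjective _ (algebraMap K E).rangeRestrict_surjective
    (p.map (Subring.inclusion hle))
  have hinj : Function.Injective (algebraMap K E).rangeRestrict := RingHom.injective _
  refine IsIntegral.isAlgebraic ⟨q, Polynomial.monic_of_injective hinj (hq ▸ hp.map _), ?_⟩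
  have : algebraMap K E = (algebraMap K E).range.subtype.comp (algebraMap K E).rangeRestrict := rfl
  rw [this, ← Polynomial.eval₂_map, hq, Polynomial.eval₂_map]
  exact hpy

open IntermediateField algebraAdjoinAdjoin in
theorem Transcendental.finiteDimensional_algebraicClosure {K E : Type*} [Field K] [Field E]
    [Algebra K E] {x : E} (hx : Transcendental K x) [FiniteDimensional K⟮x⟯ E] :
    FiniteDimensional K (algebraicClosure K E) := by
  suffices h : Module.rank K (algebraicClosure K E) ≤ (Module.finrank K⟮x⟯ E : ℕ) from
    Module.rank_lt_aleph0_iff.1 (h.trans_lt (Cardinal.natCast_lt_aleph0))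
  refine rank_le fun s hs ↦ ?_
  have hli : LinearIndependent (Algebra.adjoin K {x})
      (fun i : s ↦ ((i : algebraicClosure K E) : E)) := by
    rw [Fintype.linearIndependent_iff]
    intro c hc i
    choose p hp using fun i ↦ (Polynomial.algEquivOfTranscendental K x hx).surjective (c i)
    have hp' (i) : Polynomial.aeval x (p i) = (c i : E) := by
      rw [← hp, Polynomial.algEquivOfTranscendental_apply, Polynomial.aeval_subalgebra_coe]
    have hP : ∑ i : s, Polynomial.C (i : algebraicClosure K E) *
        (p i).map (algebraMap K (algebraicClosure K E)) = 0 := by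
      refine (transcendental_iff_injective.1 hx.algebraicClosure) ?_
      rw [map_zero, map_sum, ← hc]
      refine Finset.sum_congr rfl fun i _ ↦ ?_
      rw [map_mul, Polynomial.aeval_C, Polynomial.aeval_map_algebraMap, hp', mul_comm]
      rfl
    have hpi : p i = 0 := by
      ext j
      refine Fintype.linearIndependent_iff.1 hs (fun i ↦ (p i).coeff j) ?_ i
      rw [← Polynomial.coeff_zero j, ← hP, Polynomial.finsetSum_coeff]
      refine Finset.sum_congr rfl fun i _ ↦ ?_
      rw [Polynomial.coeff_C_mul, Polynomial.coeff_map, Algebra.smul_def, mul_comm]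
    rw [← hp, hpi, map_zero]
  rw [LinearIndependent.iff_fractionRing _ K⟮x⟯] at hli
  simpa using hli.fintype_card_le_finrank

open IntermediateField in
theorem Transcendental.rootClosuresFG {K E : Type*} [Field K] [Field E] [CharZero K]
    [Algebra K E] {x : E} (hx : Transcendental K x) [hfin : FiniteDimensional K⟮x⟯ E]
    (h : Field.RootClosuresFG (algebraicClosure K E)) : Field.RootClosuresFG E := by
  intro A Γ hA hΓ
  have hx' : Transcendental K x⁻¹ := by
    rwa [Transcendental, IsAlgebraic.inv_iff]
  have hxx : K⟮x⁻¹⟯ = K⟮x⟯ := by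
    refine le_antisymm ?_ ?_ <;> rw [adjoin_simple_le_iff]
    · exact inv_mem (mem_adjoin_simple_self K x)
    · simpa using inv_mem (mem_adjoin_simple_self K x⁻¹)
  have : FiniteDimensional K⟮x⁻¹⟯ E := hxx ▸ hfin
  have := hx.isDedekindDomain_integralClosure_adjoin
  have := hx'.isDedekindDomain_integralClosure_adjoin
  have := Transcendental.isFractionRing_integralClosure_adjoin (K := K) x
  have := Transcendental.isFractionRing_integralClosure_adjoin (K := K) x⁻¹
  refine .of_inf_units_dedekind (integralClosure (Algebra.adjoin K {x}) E) hA hΓ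
    (.of_inf_units_dedekind (integralClosure (Algebra.adjoin K {x⁻¹}) E) hA
      (fun γ hγ ↦ hΓ γ hγ.1) ?_)
  set Γ' := (Γ ⊓ (Units.map (algebraMap (integralClosure (Algebra.adjoin K {x}) E) E :
    integralClosure (Algebra.adjoin K {x}) E →* E)).range) ⊓
      (Units.map (algebraMap (integralClosure (Algebra.adjoin K {x⁻¹}) E) E :
    integralClosure (Algebra.adjoin K {x⁻¹}) E →* E)).range
  let f : (algebraicClosure K E)ˣ →* Eˣ :=
    Units.map (algebraMap (algebraicClosure K E) E : algebraicClosure K E →* E)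
  have hf : Function.Injective f := Units.map_injective
    (f := (algebraMap (algebraicClosure K E) E : algebraicClosure K E →* E))
    (FaithfulSMul.algebraMap_injective _ E)
  have hfg : (Γ'.comap f).FG := h (A.comap f) _ (hA.comap_of_injective f hf) fun γ hγ ↦ by
    obtain ⟨n, hn, hγn⟩ := hΓ _ hγ.1.1
    exact ⟨n, hn, by rwa [Subgroup.mem_comap, map_pow]⟩
  refine (hfg.map f).of_le fun γ hγ ↦ ?_
  have halg (γ) (hγ : γ ∈ Γ') : (γ : E) ∈ algebraicClosure K E := by
    obtain ⟨⟨-, u, rfl⟩, v, hv⟩ := hγ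
    refine mem_algebraicClosure_iff.2
      (isAlgebraic_of_isIntegral_adjoin_of_isIntegral_adjoin_inv (x := x) u.1.2 ?_)
    rw [← hv]
    exact v.1.2
  have hγe : f ⟨⟨γ, halg γ hγ⟩, ⟨_, halg _ (inv_mem hγ)⟩, Subtype.ext γ.mul_inv,
    Subtype.ext γ.inv_mul⟩ = γ := Units.ext rfl
  exact ⟨_, Subgroup.mem_comap.2 (hγe.symm ▸ hγ), hγe⟩

open IntermediateField in
theorem IntermediateField.rootClosuresFG {F Ω : Type*} [Field F] [Field Ω] [CharZero F]
    [Algebra F Ω] (hF : ∀ (E : Type v) [Field E] [Algebra F E] [FiniteDimensional F E],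
      Field.RootClosuresFG E) {K : IntermediateField F Ω} (hK : K.FG) :
    ∀ (E : Type v) [Field E] [Algebra K E] [FiniteDimensional K E], Field.RootClosuresFG E := by
  obtain ⟨S, rfl⟩ := hK
  refine induction_on_adjoin_finset S (fun K ↦ ∀ (E : Type v) [Field E] [Algebra K E]
    [FiniteDimensional K E], Field.RootClosuresFG E) ?_ ?_
  · intro E _ _ _
    let : Algebra F E :=
      ((algebraMap (⊥ : IntermediateField F Ω) E).comp (algebraMap F _)).toAlgebra
    have : IsScalarTower F (⊥ : IntermediateField F Ω) E := .of_algebraMap_eq fun _ ↦ rfl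
    have : FiniteDimensional F E := .trans F (⊥ : IntermediateField F Ω) E
    exact hF E
  · intro K x _ ih E _ _ hE
    let : Algebra K⟮x⟯ E := inferInstanceAs (Algebra (K⟮x⟯.restrictScalars F) E)
    have : FiniteDimensional K⟮x⟯ E := hE
    let : Algebra K E := ((algebraMap K⟮x⟯ E).comp (algebraMap K K⟮x⟯)).toAlgebra
    have : IsScalarTower K K⟮x⟯ E := .of_algebraMap_eq fun _ ↦ rfl
    by_cases hx : IsAlgebraic K x
    · have := adjoin.finiteDimensional hx.isIntegral
      have : FiniteDimensional K E := .trans K K⟮x⟯ E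
      exact ih E
    · let φ : K⟮x⟯ →ₐ[K] E := IsScalarTower.toAlgHom K K⟮x⟯ E
      let y : E := φ (AdjoinSimple.gen K x)
      have hy : Transcendental K y := fun h ↦ hx <| by
        have h' := (isAlgebraic_algHom_iff φ φ.injective).1 h
        exact (isAlgebraic_algHom_iff K⟮x⟯.val K⟮x⟯.val.injective).2 h'
      have hφ (z : K⟮x⟯) : φ z ∈ K⟮y⟯ := by
        have hle : K⟮x⟯ ≤ (K⟮y⟯.comap φ).map K⟮x⟯.val := by
          rw [adjoin_simple_le_iff]
          exact ⟨AdjoinSimple.gen K x, mem_adjoin_simple_self K y, rfl⟩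
        obtain ⟨w, hw, hwz⟩ := hle z.2
        rwa [← Subtype.ext hwz]
      have : FiniteDimensional K⟮y⟯ E := by
        obtain ⟨s, hs⟩ := hE
        refine ⟨s, top_le_iff.1 fun z _ ↦ ?_⟩
        have hz : z ∈ Submodule.span K⟮x⟯ (s : Set E) := hs ▸ Submodule.mem_top
        induction hz using Submodule.span_induction with
        | mem z hz => exact Submodule.subset_span hz
        | zero => exact zero_mem _
        | add z w _ _ hz hw => exact add_mem (hz trivial) (hw trivial)
        | smul a z _ hz =>
          have : a • z = (⟨φ a, hφ a⟩ : K⟮y⟯) • z := Algebra.smul_def a z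
          exact this ▸ Submodule.smul_mem _ _ (hz trivial)
      have := charZero_of_injective_algebraMap (algebraMap F K).injective
      have := hy.finiteDimensional_algebraicClosure
      exact hy.rootClosuresFG (ih _)

theorem IntermediateField.FG.rootClosuresFG {Ω : Type*} [Field Ω] [CharZero Ω]
    {L : IntermediateField ℚ Ω} (hL : L.FG) : Field.RootClosuresFG L := by
  refine IntermediateField.rootClosuresFG (fun E _ hQ hE ↦ ?_) hL L
  have := charZero_of_injective_algebraMap (algebraMap ℚ E).injective
  obtain rfl : hQ = DivisionRing.toRatAlgebra := Subsingleton.elim _ _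
  have : NumberField E := { to_finiteDimensional := hE }
  exact NumberField.rootClosuresFG E

/-- In a finitely generated field of characteristic zero, a group of units that is torsion modulo a
finitely generated group is finitely generated. -/
theorem IntermediateField.FG.subgroup_fg {Ω : Type*} [Field Ω] [CharZero Ω]
    {L : IntermediateField ℚ Ω} (hL : L.FG) {A Γ : Subgroup Ωˣ} (hA : A.FG)
    (hΓ : ∀ γ ∈ Γ, ∃ n : ℕ, 0 < n ∧ γ ^ n ∈ A) (hΓL : ∀ γ ∈ Γ, (γ : Ω) ∈ L) : Γ.FG := by
  let f : Lˣ →* Ωˣ := Units.map (L.val : L →* Ω)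
  have hf : Function.Injective f := Units.map_injective (f := (L.val : L →* Ω)) L.val.injective
  have hfg : (Γ.comap f).FG := hL.rootClosuresFG (A.comap f) _ (hA.comap_of_injective f hf)
    fun γ hγ ↦ by
      obtain ⟨n, hn, hγn⟩ := hΓ _ hγ
      exact ⟨n, hn, by rwa [Subgroup.mem_comap, map_pow]⟩
  refine (hfg.map f).of_le fun γ hγ ↦ ?_
  have hγe : f ⟨⟨γ, hΓL γ hγ⟩, ⟨_, hΓL _ (inv_mem hγ)⟩, Subtype.ext γ.mul_inv,
    Subtype.ext γ.inv_mul⟩ = γ := Units.ext rfl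
  exact ⟨_, Subgroup.mem_comap.2 (hγe.symm ▸ hγ), hγe⟩

theorem Subgroup.FG.exists_pow_mem {G : Type*} [CommGroup G] {H A : Subgroup G} (hH : H.FG)
    (h : ∀ γ ∈ H, ∃ n : ℕ, 0 < n ∧ γ ^ n ∈ A) : ∃ n : ℕ, 0 < n ∧ ∀ γ ∈ H, γ ^ n ∈ A := by
  obtain ⟨S, rfl⟩ := hH
  choose! n hn hnA using h
  have hS (s) (hs : s ∈ S) := hn s (Subgroup.subset_closure hs)
  refine ⟨∏ s ∈ S, n s, Finset.prod_pos hS, fun γ hγ ↦ ?_⟩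
  suffices Subgroup.closure (S : Set G) ≤ A.comap (powMonoidHom (∏ s ∈ S, n s)) from this hγ
  rw [Subgroup.closure_le]
  intro s hs
  obtain ⟨m, hm⟩ := Finset.dvd_prod_of_mem n hs
  simp only [Subgroup.coe_comap, Set.mem_preimage, powMonoidHom_apply, SetLike.mem_coe, hm, pow_mul]
  exact pow_mem (hnA s (Subgroup.subset_closure hs)) m

/-- Any element of `Γ` with the same `p`-th power as some element of `L` lies in `L`. -/
def Subgroup.RootsMem {Ω : Type*} [Field Ω] [CharZero Ω] (Γ : Subgroup Ωˣ)
    (L : IntermediateField ℚ Ω) (p : ℕ) : Prop :=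
  ∀ g ∈ Γ, ∀ l ∈ L, (g : Ω) ^ p = l ^ p → (g : Ω) ∈ L

theorem Subgroup.exists_rootsMem_of_lt {Ω : Type*} [Field Ω] [CharZero Ω]
    {L : IntermediateField ℚ Ω} (hL : L.FG) {A Γ : Subgroup Ωˣ} (hA : A.FG) (hAΓ : A ≤ Γ)
    (hΓ : ∀ γ ∈ Γ, ∃ n : ℕ, 0 < n ∧ γ ^ n ∈ A)
    (htors : ∃ N : ℕ, ∀ p : ℕ, p.Prime → N < p → ∀ γ ∈ Γ, γ ^ p = 1 → γ = 1) :
    ∃ N : ℕ, ∀ p : ℕ, p.Prime → N < p → Γ.RootsMem L p := by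
  let H : Subgroup Ωˣ :=
    { carrier := {l | (l : Ω) ∈ L ∧ ∃ j : ℕ, 0 < j ∧ l ^ j ∈ A}
      one_mem' := ⟨by simp, 1, one_pos, by simp⟩
      mul_mem' := by
        rintro a b ⟨ha, i, hi, hai⟩ ⟨hb, j, hj, hbj⟩
        refine ⟨by simpa using mul_mem ha hb, i * j, mul_pos hi hj, ?_⟩
        rw [mul_pow, pow_mul, mul_comm i, pow_mul]
        exact mul_mem (pow_mem hai j) (pow_mem hbj i)
      inv_mem' := by
        rintro a ⟨ha, i, hi, hai⟩
        exact ⟨by simpa using ha, i, hi, by simpa using hai⟩ }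
  have hH : H.FG := hL.subgroup_fg hA (fun γ hγ ↦ hγ.2) fun γ hγ ↦ hγ.1
  obtain ⟨m, hm, hmA⟩ := hH.exists_pow_mem fun γ hγ ↦ hγ.2
  obtain ⟨N, hN⟩ := htors
  refine ⟨max N m, fun p hp hlt g hg l hl hgl ↦ ?_⟩
  have hl0 : l ≠ 0 := by
    rintro rfl
    rw [zero_pow hp.ne_zero] at hgl
    exact g.ne_zero (pow_eq_zero_iff hp.ne_zero |>.1 hgl)
  lift l to Ωˣ using hl0.isUnit
  have hgl' : g ^ p = l ^ p := Units.ext (by simpa using hgl)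
  have hlH : l ∈ H := by
    obtain ⟨j, hj, hgj⟩ := hΓ g hg
    refine ⟨hl, p * j, mul_pos hp.pos hj, ?_⟩
    rw [pow_mul, ← hgl', ← pow_mul, mul_comm, pow_mul]
    exact pow_mem hgj p
  have hu : (g / l) ^ p = 1 := by rw [div_pow, hgl', div_self']
  have hum : (g / l) ^ m = 1 := by
    refine hN p hp ((le_max_left _ _).trans_lt hlt) _ ?_ ?_
    · rw [div_pow]
      exact div_mem (pow_mem hg m) (hAΓ (hmA l hlH))
    · rw [← pow_mul, mul_comm, pow_mul, hu, one_pow]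
  have hcop : p.Coprime m :=
    (Nat.Prime.coprime_iff_not_dvd hp).2
      (Nat.not_dvd_of_pos_of_lt hm ((le_max_right _ _).trans_lt hlt))
  have : g / l = 1 := by
    simpa [hcop.gcd_eq_one] using pow_gcd_eq_one.2 ⟨hu, hum⟩
  rwa [div_eq_one.1 this]

theorem IntermediateField.exists_pow_eq_of_pow_mem {K E : Type*} [Field K] [Field E] [Algebra K E]
    [FiniteDimensional K E] {q : ℕ} (hq : q.Prime) (hlt : Module.finrank K E < q) {y : E} {a : K}
    (hy : y ^ q = algebraMap K E a) : ∃ e : K, e ^ q = a := by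
  by_contra! h
  have hirr := X_pow_sub_C_irreducible_of_prime hq h
  have := minpoly.natDegree_le (A := K) y
  rw [← minpoly.eq_of_irreducible_of_monic hirr (by simp [hy])
    (Polynomial.monic_X_pow_sub_C a hq.ne_zero),
    Polynomial.natDegree_X_pow_sub_C] at this
  exact hlt.not_ge this

theorem IsPrimitiveRoot.finrank_adjoin_lt {K E : Type*} [Field K] [Field E] [Algebra K E]
    {ζ : E} {n : ℕ} (hζ : IsPrimitiveRoot ζ n) (hn : 1 < n) :
    FiniteDimensional K (IntermediateField.adjoin K {ζ}) ∧
      Module.finrank K (IntermediateField.adjoin K {ζ}) < n := by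
  have hint : IsIntegral K ζ := hζ.isIntegral (hn.trans' one_pos) |>.tower_top
  refine ⟨IntermediateField.adjoin.finiteDimensional hint, ?_⟩
  rw [IntermediateField.adjoin.finrank hint]
  have hdvd : minpoly K ζ ∣ Polynomial.cyclotomic n K := minpoly.dvd _ _ <| by
    have := hζ.isRoot_cyclotomic (hn.trans' one_pos)
    rwa [← Polynomial.map_cyclotomic n (algebraMap K E), Polynomial.IsRoot,
      Polynomial.eval_map_algebraMap] at this
  refine (Polynomial.natDegree_le_of_dvd hdvd (Polynomial.cyclotomic_ne_zero n K)).trans_lt ?_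
  rw [Polynomial.natDegree_cyclotomic]
  exact Nat.totient_lt n hn

theorem mem_of_pow_mem_of_coprime {Ω : Type*} [Field Ω] {L : Subfield Ω} {g : Ω}
    {m n : ℕ} (h : m.Coprime n) (hm : g ^ m ∈ L) (hn : g ^ n ∈ L) : g ∈ L := by
  rcases eq_or_ne g 0 with rfl | hg
  · exact zero_mem L
  have : g = (g ^ m) ^ m.gcdA n * (g ^ n) ^ m.gcdB n := by
    rw [← zpow_natCast, ← zpow_natCast, ← zpow_mul, ← zpow_mul, ← zpow_add₀ hg, ← Nat.gcd_eq_gcd_ab,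
      h.gcd_eq_one, Nat.cast_one, zpow_one]
  rw [this]
  exact mul_mem (zpow_mem hm _) (zpow_mem hn _)

/-- If every element of `Γ ∩ L'` with `q`-th power in `L` lies in `L`, the same holds for `q ^ s`-th
powers. -/
theorem Subgroup.mem_of_pow_prime_pow_mem {Ω : Type*} [Field Ω] {Γ : Subgroup Ωˣ}
    {L L' : Subfield Ω} {q : ℕ}
    (h : ∀ x ∈ Γ, (x : Ω) ∈ L' → (x : Ω) ^ q ∈ L → (x : Ω) ∈ L) (s : ℕ) :
    ∀ x ∈ Γ, (x : Ω) ∈ L' → (x : Ω) ^ q ^ s ∈ L → (x : Ω) ∈ L := by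
  induction s with
  | zero => simp
  | succ s ih =>
    intro x hx hx' hxs
    refine h x hx hx' ?_
    have := ih (x ^ q) (pow_mem hx q) (by simpa using pow_mem hx' q)
    rw [Units.val_pow_eq_pow_val, ← pow_mul, ← pow_succ'] at this
    exact this hxs

open IntermediateField in
/-- Adjoining to `L` an element of degree less than a prime `q` preserves `Γ.RootsMem L q`. -/
theorem Subgroup.RootsMem.adjoin {Ω : Type*} [Field Ω] [CharZero Ω]
    {L : IntermediateField ℚ Ω} {Γ : Subgroup Ωˣ}
    (hΓ : ∀ γ ∈ Γ, ∃ n : ℕ, 0 < n ∧ (γ : Ω) ^ n ∈ L) {q : ℕ} (hq : q.Prime)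
    (h : Γ.RootsMem L q) {ζ : Ω} [FiniteDimensional L L⟮ζ⟯] (hlt : Module.finrank L L⟮ζ⟯ < q) :
    Γ.RootsMem (L⟮ζ⟯.restrictScalars ℚ) q := by
  have hroot (y : Ω) (hy : y ∈ L⟮ζ⟯) (hyq : y ^ q ∈ L) : ∃ e ∈ L, y ^ q = e ^ q := by
    obtain ⟨e, he⟩ := exists_pow_eq_of_pow_mem (y := (⟨y, hy⟩ : L⟮ζ⟯)) (a := ⟨y ^ q, hyq⟩) hq hlt
      (Subtype.ext rfl)
    exact ⟨e, e.2, (congr_arg Subtype.val he).symm⟩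
  have hL (x) (hx : x ∈ Γ) (hx' : (x : Ω) ∈ L⟮ζ⟯) (hxq : (x : Ω) ^ q ∈ L) : (x : Ω) ∈ L := by
    obtain ⟨e, he, hxe⟩ := hroot x hx' hxq
    exact h x hx e he hxe
  have hLL (z : Ω) (hz : z ∈ L) : z ∈ L⟮ζ⟯ := L⟮ζ⟯.algebraMap_mem ⟨z, hz⟩
  intro g hg l hl hgl
  rw [mem_restrictScalars] at hl ⊢
  obtain ⟨m, hm, hgm⟩ := hΓ g hg
  obtain ⟨s, m', hm', rfl⟩ := Nat.exists_eq_pow_mul_and_not_dvd hm.ne' q hq.ne_one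
  have hgq : (g : Ω) ^ q ∈ L⟮ζ⟯ := hgl ▸ pow_mem hl q
  refine mem_of_pow_mem_of_coprime (L := L⟮ζ⟯.toSubfield)
    ((Nat.Prime.coprime_iff_not_dvd hq).2 hm') hgq (hLL _ ?_)
  rw [mul_comm, pow_mul] at hgm
  cases s with
  | zero => simpa using hgm
  | succ s =>
    have hgq' : ((g : Ω) ^ m') ^ q ∈ L := by
      have := mem_of_pow_prime_pow_mem (L := L.toSubfield) (L' := L⟮ζ⟯.toSubfield) hL s
        ((g ^ m') ^ q) (pow_mem (pow_mem hg _) _)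
      push_cast at this
      rw [← pow_mul _ q, ← pow_succ'] at this
      refine this ?_ hgm
      rw [pow_right_comm]
      exact pow_mem hgq m'
    have hlq : (l ^ m') ^ q ∈ L := by
      rwa [pow_right_comm, ← hgl, pow_right_comm]
    obtain ⟨e, he, hle⟩ := hroot _ (pow_mem hl m') hlq
    have := h (g ^ m') (pow_mem hg m') e he
    push_cast at this
    refine this ?_
    rw [← hle, pow_right_comm, hgl, pow_right_comm]

open IntermediateField in
theorem Subgroup.exists_rootsMem_of_lt_of_succ_le {Ω : Type*} [Field Ω] [CharZero Ω] [IsAlgClosed Ω]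
    {L : IntermediateField ℚ Ω} (hL : L.FG) {Γ : Subgroup Ωˣ}
    (hΓ : ∀ γ ∈ Γ, ∃ n : ℕ, 0 < n ∧ (γ : Ω) ^ n ∈ L) (n : ℕ)
    (h : ∀ p : ℕ, p.Prime → n < p → Γ.RootsMem L p) :
    ∃ L' : IntermediateField ℚ Ω, L'.FG ∧ L ≤ L' ∧ ∀ p : ℕ, p.Prime → n ≤ p → Γ.RootsMem L' p := by
  by_cases hn : n.Prime
  · have := NeZero.of_pos hn.pos
    obtain ⟨ζ, hζ⟩ := HasEnoughRootsOfUnity.exists_primitiveRoot Ω n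
    obtain ⟨hfin, hlt⟩ := hζ.finrank_adjoin_lt (K := L) hn.one_lt
    refine ⟨L⟮ζ⟯.restrictScalars ℚ, ?_, fun z hz ↦ L⟮ζ⟯.algebraMap_mem ⟨z, hz⟩,
      fun p hp hnp ↦ ?_⟩
    · obtain ⟨S, rfl⟩ := hL
      classical
      exact ⟨S ∪ {ζ}, by
        rw [Finset.coe_union, Finset.coe_singleton]
        exact (adjoin_adjoin_left ℚ _ _).symm⟩
    · rcases hnp.eq_or_lt with rfl | hnp
      · intro g hg l hl hgl
        rw [mem_restrictScalars] at hl ⊢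
        rcases eq_or_ne l 0 with rfl | hl0
        · rw [zero_pow hp.ne_zero] at hgl
          exact absurd (pow_eq_zero_iff hp.ne_zero |>.1 hgl) g.ne_zero
        obtain ⟨i, -, hi⟩ := hζ.eq_pow_of_pow_eq_one (ξ := g / l) (by
          rw [div_pow, hgl, div_self (pow_ne_zero _ hl0)])
        rw [← (eq_div_iff hl0).1 hi]
        exact mul_mem (pow_mem (mem_adjoin_simple_self L ζ) i) hl
      · exact (h p hp hnp).adjoin hΓ hp (hlt.trans hnp)
  · exact ⟨L, hL, le_rfl, fun p hp hnp ↦ h p hp (hnp.lt_of_ne fun hne ↦ hn (hne ▸ hp))⟩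

/-- A finitely generated field `L₀` is contained in a finitely generated field `L` such that any
element of `Γ` with the same `p`-th power as some element of `L`, `p` prime, lies in `L`. -/
theorem Subgroup.exists_forall_rootsMem {Ω : Type*} [Field Ω] [CharZero Ω] [IsAlgClosed Ω]
    {L₀ : IntermediateField ℚ Ω} (hL₀ : L₀.FG) {A Γ : Subgroup Ωˣ} (hA : A.FG) (hAΓ : A ≤ Γ)
    (hΓ : ∀ γ ∈ Γ, ∃ n : ℕ, 0 < n ∧ γ ^ n ∈ A) (hAL : ∀ a ∈ A, (a : Ω) ∈ L₀)
    (htors : ∃ N : ℕ, ∀ p : ℕ, p.Prime → N < p → ∀ γ ∈ Γ, γ ^ p = 1 → γ = 1) :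
    ∃ L : IntermediateField ℚ Ω, L.FG ∧ L₀ ≤ L ∧ ∀ p : ℕ, p.Prime → Γ.RootsMem L p := by
  obtain ⟨N, hN⟩ := exists_rootsMem_of_lt hL₀ hA hAΓ hΓ htors
  obtain ⟨L, hL, hLL, h⟩ : ∃ L : IntermediateField ℚ Ω, L.FG ∧ L₀ ≤ L ∧
      ∀ p : ℕ, p.Prime → 0 < p → Γ.RootsMem L p := by
    refine Nat.decreasingInduction (n := N) (motive := fun n _ ↦
      ∃ L : IntermediateField ℚ Ω, L.FG ∧ L₀ ≤ L ∧ ∀ p : ℕ, p.Prime → n < p → Γ.RootsMem L p)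
      ?_ ⟨L₀, hL₀, le_rfl, hN⟩ (Nat.zero_le N)
    rintro n - ⟨L, hL, hLL, h⟩
    obtain ⟨L', hL', hLL', h'⟩ := exists_rootsMem_of_lt_of_succ_le hL (fun γ hγ ↦ by
      obtain ⟨m, hm, hγm⟩ := hΓ γ hγ
      exact ⟨m, hm, by simpa using hLL (hAL _ hγm)⟩) (n + 1) h
    exact ⟨L', hL', hLL.trans hLL', h'⟩
  exact ⟨L, hL, hLL, fun p hp ↦ h p hp hp.pos⟩

open Polynomial IntermediateField in
/-- **Capelli's theorem** over a field containing a square root of `-1`. -/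
theorem X_pow_sub_C_irreducible_of_sq_eq_neg_one {K : Type*} [Field K] {ι : K} (hι : ι ^ 2 = -1)
    {n : ℕ} (hn : n ≠ 0) {a : K} (ha : ∀ p : ℕ, p.Prime → p ∣ n → ∀ b : K, b ^ p ≠ a) :
    Irreducible (X ^ n - C a) := by
  induction n using induction_on_primes generalizing K a with
  | zero => exact absurd rfl hn
  | one => simpa using irreducible_X_sub_C a
  | prime_mul p n hp IH =>
    rw [mul_comm]
    apply X_pow_mul_sub_C_irreducible
      (X_pow_sub_C_irreducible_of_prime hp (ha p hp (dvd_mul_right _ _)))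
    intro E _ _ x hx
    have hint : IsIntegral K x := not_not.mp fun h ↦ by
      simpa only [degree_zero, degree_X_pow_sub_C hp.pos,
        WithBot.natCast_ne_bot] using congr_arg degree (hx.symm.trans (dif_neg h))
    refine IH (ι := algebraMap K K⟮x⟯ ι) (by rw [← map_pow, hι, map_neg, map_one])
      (right_ne_zero_of_mul hn) fun q hq hqn b hb ↦ ?_
    have haq := ha q hq (dvd_mul_of_dvd_right hqn p)
    have hnorm : Algebra.norm K b ^ q = (-1) ^ p * -a := by
      rw [← map_pow, hb, ← adjoin.powerBasis_gen hint,
        Algebra.PowerBasis.norm_gen_eq_coeff_zero_minpoly]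
      simp [minpoly_gen, hx, hp.ne_zero.symm]
    rcases hp.eq_two_or_odd' with rfl | hp
    · rcases hq.eq_two_or_odd' with rfl | hq
      · exact haq (ι * Algebra.norm K b) (by rw [mul_pow, hι, hnorm]; ring)
      · exact haq (-Algebra.norm K b) (by rw [hq.neg_pow, hnorm]; ring)
    · exact haq (Algebra.norm K b) (by rw [hnorm, hp.neg_one_pow]; ring)

/-- The normalized trace from `Ω` to `L` vanishes on the elements of `Γ` outside `L`. -/
theorem Subgroup.normalizedTrace_eq_zero {Ω : Type*} [Field Ω] [CharZero Ω]
    {L : IntermediateField ℚ Ω} [Algebra.IsIntegral L Ω] {Γ : Subgroup Ωˣ}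
    (hroots : ∀ p : ℕ, p.Prime → Γ.RootsMem L p) {ι : L} (hι : ι ^ 2 = -1) {x : Ωˣ} (hx : x ∈ Γ)
    (hpow : ∃ n : ℕ, 0 < n ∧ (x : Ω) ^ n ∈ L) (hxL : (x : Ω) ∉ L) :
    Algebra.normalizedTrace L Ω (x : Ω) = 0 := by
  classical
  obtain ⟨hn, hxn⟩ := Nat.find_spec hpow
  have hmin (m : ℕ) := Nat.find_min (H := hpow) (m := m)
  set n := Nat.find hpow
  have hirr := X_pow_sub_C_irreducible_of_sq_eq_neg_one hι hn.ne' (a := ⟨(x : Ω) ^ n, hxn⟩)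
    fun p hp ⟨m, hm⟩ b hb ↦ by
      have hm0 : 0 < m := Nat.pos_of_ne_zero (by rintro rfl; simp [hm] at hn)
      have hmn : m < n := by
        rw [hm]
        exact lt_mul_left hm0 hp.one_lt
      refine hmin m hmn ⟨hm0, ?_⟩
      have := hroots p hp (x ^ m) (pow_mem hx m) b b.2
      push_cast at this
      refine this ?_
      rw [← pow_mul, mul_comm, ← hm]
      exact congr_arg Subtype.val hb.symm
  have hn1 : 1 < n := by
    refine lt_of_le_of_ne hn fun h ↦ hxL ?_
    rwa [← h, pow_one] at hxn
  rw [Algebra.normalizedTrace_minpoly, ← minpoly.eq_of_irreducible_of_monic hirr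
    (by simp [IntermediateField.algebraMap_apply]) (Polynomial.monic_X_pow_sub_C _ hn.ne'),
    Polynomial.nextCoeff_of_natDegree_pos (by simpa using hn), Polynomial.natDegree_X_pow_sub_C]
  rw [Polynomial.coeff_sub, Polynomial.coeff_X_pow, Polynomial.coeff_C, if_neg (by lia),
    if_neg (by lia), sub_zero, neg_zero, smul_zero]

theorem Subgroup.ofMul_mem_span_int_image {G : Type*} [CommGroup G] {s : Set G} {x : G} :
    Additive.ofMul x ∈ Submodule.span ℤ (Additive.ofMul '' s) ↔ x ∈ Subgroup.closure s := by
  rw [← Submodule.mem_toAddSubgroup, Submodule.span_int_eq_addSubgroupClosure,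
    Equiv.image_eq_preimage_symm]
  exact (Subgroup.toAddSubgroup_closure s ▸ Iff.rfl)

theorem CommGroup.exists_fg_forall_pow_mem {G : Type*} [CommGroup G]
    (hrk : ∃ n : ℕ, ∀ H : Subgroup G, H.FG →
      ∃ s : Finset G, s.card ≤ n ∧ Subgroup.closure (s : Set G) = H) :
    ∃ A : Subgroup G, A.FG ∧ ∀ g : G, ∃ n : ℕ, 0 < n ∧ g ^ n ∈ A := by
  classical
  obtain ⟨n, hn⟩ := hrk
  have hcard (t : Finset G) (ht : LinearIndepOn ℤ (Additive.ofMul : G → Additive G) (t : Set G)) :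
      t.card ≤ n := by
    obtain ⟨s, hs, hst⟩ := hn (Subgroup.closure t) ⟨t, rfl⟩
    have := linearIndependent_le_span' _ ht (s.image Additive.ofMul : Finset (Additive G)) ?_
    · have h := (Finset.card_image_le (s := s) (f := Additive.ofMul)).trans hs
      rw [← Fintype.card_coe] at h
      simpa using this.trans (Nat.cast_le.2 h)
    · rintro - ⟨x, rfl⟩
      rw [SetLike.mem_coe, Finset.coe_image, Subgroup.ofMul_mem_span_int_image, hst]
      exact Subgroup.subset_closure x.2
  obtain ⟨I, hI, hmax⟩ := exists_maximal_linearIndepOn ℤ (Additive.ofMul : G → Additive G)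
  have hfin : I.Finite := by
    by_contra h
    obtain ⟨t, htI, ht⟩ := Set.Infinite.exists_subset_card_eq h (n + 1)
    have := hcard t (hI.mono htI)
    lia
  refine ⟨Subgroup.closure I, ⟨hfin.toFinset, by simp⟩, fun g ↦ ?_⟩
  by_cases hg : g ∈ I
  · exact ⟨1, one_pos, by simpa using Subgroup.subset_closure hg⟩
  · obtain ⟨a, ha, hag⟩ := hmax g hg
    rw [← ofMul_zpow, Subgroup.ofMul_mem_span_int_image] at hag
    refine ⟨a.natAbs, Int.natAbs_pos.2 ha, ?_⟩
    rw [← zpow_natCast]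
    obtain h | h := a.natAbs_eq
    · rwa [← h]
    · rwa [← inv_mem_iff, ← zpow_neg, ← h]

theorem CommGroup.exists_forall_prime_pow_eq_one {G : Type*} [CommGroup G]
    (hmin : WellFoundedLT (Subgroup (CommGroup.torsion G))) :
    ∃ N : ℕ, ∀ p : ℕ, p.Prime → N < p → ∀ g : G, g ^ p = 1 → g = 1 := by
  let K (n : ℕ) : Subgroup (CommGroup.torsion G) :=
    { carrier := {g | ∃ m : ℕ, m.Coprime n.factorial ∧ g ^ m = 1}
      one_mem' := ⟨1, by simp, by simp⟩
      mul_mem' := by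
        rintro a b ⟨i, hi, hai⟩ ⟨j, hj, hbj⟩
        exact ⟨i * j, hi.mul_left hj, by rw [mul_pow, pow_mul, hai, mul_comm i, pow_mul, hbj]; simp⟩
      inv_mem' := by
        rintro a ⟨i, hi, hai⟩
        exact ⟨i, hi, by simp [hai]⟩ }
  have hK : Antitone K := fun i j hij g ⟨m, hm, hgm⟩ ↦
    ⟨m, hm.coprime_dvd_right (Nat.factorial_dvd_factorial hij), hgm⟩
  obtain ⟨N, hN⟩ := WellFoundedGT.monotone_chain_condition
    (⟨fun n ↦ OrderDual.toDual (K n), hK⟩ : ℕ →o (Subgroup (CommGroup.torsion G))ᵒᵈ)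
  refine ⟨N, fun p hp hlt g hg ↦ ?_⟩
  let g' : CommGroup.torsion G := ⟨g, isOfFinOrder_iff_pow_eq_one.2 ⟨p, hp.pos, hg⟩⟩
  have hgN : g' ∈ K N := ⟨p, (Nat.coprime_factorial_iff hp.ne_one).2 (by rwa [hp.minFac_eq]),
    Subtype.ext hg⟩
  rw [show K N = K p from hN p hlt.le] at hgN
  obtain ⟨m, hm, hgm⟩ := hgN
  have hcop : m.Coprime p := hm.coprime_dvd_right (Nat.dvd_factorial hp.pos le_rfl)
  have hgm' : g ^ m = 1 := congr_arg Subtype.val hgm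
  simpa [hcop.gcd_eq_one] using pow_gcd_eq_one.2 ⟨hgm', hg⟩

open IntermediateField in
/-- A finitely generated field `L` containing `k`, modulo which `G` is torsion and intersecting `G`
in a finitely generated subgroup, such that the elements of `G` outside `L` have trace zero
over `L`. -/
theorem Subgroup.exists_normalizedTrace_eq_zero {k : Type*} [Field k] [CharZero k]
    (hk : ∃ S : Set k, S.Finite ∧ IntermediateField.adjoin ℚ S = ⊤)
    {G : Type*} [CommGroup G]
    (hrk : ∃ n : ℕ, ∀ H : Subgroup G, H.FG →
      ∃ s : Finset G, s.card ≤ n ∧ Subgroup.closure (s : Set G) = H)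
    (hmin : WellFoundedLT (Subgroup (CommGroup.torsion G)))
    {Ω : Type*} [Field Ω] [CharZero Ω] [IsAlgClosed Ω] [Algebra k Ω] (ψ : G →* Ωˣ)
    (hψ : Function.Injective ψ) :
    ∃ L : IntermediateField ℚ Ω, (∀ c : k, algebraMap k Ω c ∈ L) ∧
      (∀ g : G, ∃ n : ℕ, 0 < n ∧ (ψ g : Ω) ^ n ∈ L) ∧
      (∀ [Algebra.IsIntegral L Ω] (g : G), (ψ g : Ω) ∉ L →
        Algebra.normalizedTrace L Ω (ψ g : Ω) = 0) ∧
      ∃ H : Subgroup G, H.FG ∧ ∀ g : G, g ∈ H ↔ (ψ g : Ω) ∈ L := by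
  obtain ⟨A, hA, hGA⟩ := CommGroup.exists_fg_forall_pow_mem hrk
  obtain ⟨N, hN⟩ := CommGroup.exists_forall_prime_pow_eq_one hmin
  obtain ⟨S, hS, hSk⟩ := hk
  obtain ⟨ι, hι⟩ := IsAlgClosed.exists_pow_nat_eq (-1 : Ω) two_pos
  obtain ⟨L, hL, hkL, hAL, hιL, hroots⟩ : ∃ L : IntermediateField ℚ Ω, L.FG ∧
      (∀ c : k, algebraMap k Ω c ∈ L) ∧ (∀ a ∈ A, (ψ a : Ω) ∈ L) ∧ ι ∈ L ∧
      ∀ p : ℕ, p.Prime → ψ.range.RootsMem L p := by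
    obtain ⟨B, rfl⟩ := hA
    set L₀ := adjoin ℚ (algebraMap k Ω '' S ∪ (fun b ↦ (ψ b : Ω)) '' B ∪ {ι}) with hL₀
    have hsub := subset_adjoin ℚ (algebraMap k Ω '' S ∪ (fun b ↦ (ψ b : Ω)) '' B ∪ {ι})
    have hA₀ : ∀ a ∈ Subgroup.closure (B : Set G), (ψ a : Ω) ∈ L₀ := by
      intro a ha
      induction ha using Subgroup.closure_induction with
      | mem b hb => exact hsub (.inl (.inr ⟨b, hb, rfl⟩))
      | one => simp
      | mul a b _ _ ha hb => simpa using mul_mem ha hb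
      | inv a _ ha => simpa using inv_mem ha
    obtain ⟨L, hL, hL₀L, hroots⟩ := exists_forall_rootsMem (L₀ := L₀)
      (A := (Subgroup.closure (B : Set G)).map ψ) (Γ := ψ.range)
      (fg_adjoin_of_finite (((hS.image _).union (B.finite_toSet.image _)).union
        (Set.finite_singleton ι)))
      (Subgroup.FG.map ⟨B, rfl⟩ ψ) (Subgroup.map_le_range _ _)
      (by
        rintro - ⟨g, rfl⟩
        obtain ⟨n, hn, hg⟩ := hGA g
        exact ⟨n, hn, g ^ n, hg, map_pow ψ g n⟩)
      (by
        rintro - ⟨a, ha, rfl⟩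
        exact hA₀ a ha)
      ⟨N, by
        rintro p hp hlt - ⟨g, rfl⟩ hg
        rw [hN p hp hlt g (hψ (by rw [map_pow, hg, map_one])), map_one]⟩
    refine ⟨L, hL, fun c ↦ hL₀L ?_, fun a ha ↦ hL₀L (hA₀ a ha), hL₀L (hsub (.inr rfl)), hroots⟩
    have hc : c ∈ adjoin ℚ S := hSk ▸ IntermediateField.mem_top
    have : (algebraMap k Ω).toRatAlgHom c ∈ (adjoin ℚ S).map (algebraMap k Ω).toRatAlgHom :=
      ⟨c, hc, rfl⟩
    rw [adjoin_map] at this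
    exact adjoin.mono ℚ _ _ (fun x hx ↦ .inl (.inl hx)) this
  have hpow (g : G) : ∃ n : ℕ, 0 < n ∧ (ψ g : Ω) ^ n ∈ L := by
    obtain ⟨n, hn, hg⟩ := hGA g
    exact ⟨n, hn, by simpa using hAL _ hg⟩
  let H : Subgroup G := L.toSubfield.toSubmonoid.units.comap ψ
  have hH (g : G) : g ∈ H ↔ (ψ g : Ω) ∈ L := by
    simp [H, Submonoid.mem_units_iff]
  have hHfg : H.FG := by
    refine Subgroup.FG.of_le (Subgroup.FG.comap_of_injective (K := H.map ψ) ?_ ψ hψ)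
      (Subgroup.le_comap_map ψ H)
    refine hL.subgroup_fg (hA.map ψ) ?_ ?_
    · rintro - ⟨g, -, rfl⟩
      obtain ⟨n, hn, hg⟩ := hGA g
      exact ⟨n, hn, g ^ n, hg, map_pow ψ g n⟩
    · rintro - ⟨g, hg, rfl⟩
      exact (hH g).1 hg
  exact ⟨L, hkL, hpow, fun g hg ↦
    normalizedTrace_eq_zero hroots (ι := ⟨ι, hιL⟩) (Subtype.ext hι) ⟨g, rfl⟩ (hpow g) hg,
    H, hHfg, hH⟩

open IntermediateField in
/-- A field containing a finitely generated field `k` and spanned over it by a group `G` is a direct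
sum of translates of `k[H]`, where `H` is finitely generated. -/
theorem Subgroup.exists_iSupIndep_translates {k : Type*} [Field k] [CharZero k]
    (hk : ∃ S : Set k, S.Finite ∧ IntermediateField.adjoin ℚ S = ⊤)
    {G : Type*} [CommGroup G]
    (hrk : ∃ n : ℕ, ∀ H : Subgroup G, H.FG →
      ∃ s : Finset G, s.card ≤ n ∧ Subgroup.closure (s : Set G) = H)
    (hmin : WellFoundedLT (Subgroup (CommGroup.torsion G)))
    {F : Type*} [Field F] [Algebra k F] (φ : G →* Fˣ) (hφ : Function.Injective φ)
    (hspan : Submodule.span k (Set.range fun g ↦ (φ g : F)) = ⊤) :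
    ∃ H : Subgroup G, H.FG ∧ ∃ U : Submodule k F, (∀ h ∈ H, ∀ u ∈ U, (φ h : F) * u ∈ U) ∧
      ∃ T : Set G, (∀ g : G, ∃! t, t ∈ T ∧ t⁻¹ * g ∈ H) ∧
        iSupIndep (fun t : T ↦ U.map (LinearMap.mulLeft k (φ (t : G) : F))) ∧
        (⨆ t : T, U.map (LinearMap.mulLeft k (φ (t : G) : F))) = ⊤ := by
  have : CharZero F := charZero_of_injective_algebraMap (algebraMap k F).injective
  let Ω := AlgebraicClosure F
  have : CharZero Ω := charZero_of_injective_algebraMap (algebraMap F Ω).injective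
  let ψ : G →* Ωˣ := (Units.map (algebraMap F Ω : F →* Ω)).comp φ
  have hψ : Function.Injective ψ :=
    (Units.map_injective (f := (algebraMap F Ω : F →* Ω)) (algebraMap F Ω).injective).comp hφ
  have hψφ (g) : (ψ g : Ω) = algebraMap F Ω (φ g) := rfl
  obtain ⟨L, hkL, hpow, htr, H, hHfg, hH⟩ := exists_normalizedTrace_eq_zero hk hrk hmin ψ hψ
  have hint : Algebra.IsIntegral L Ω := by
    have hF (x : F) : algebraMap F Ω x ∈ algebraicClosure L Ω := by
      have hx : x ∈ Submodule.span k (Set.range fun g ↦ (φ g : F)) := hspan ▸ Submodule.mem_top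
      induction hx using Submodule.span_induction with
      | mem x hx =>
        obtain ⟨g, rfl⟩ := hx
        obtain ⟨n, hn, hg⟩ := hpow g
        refine mem_algebraicClosure_iff.2 (IsAlgebraic.of_pow hn ?_)
        exact isAlgebraic_algebraMap (⟨_, hg⟩ : L)
      | zero => simp
      | add x y _ _ hx hy => rw [map_add]; exact add_mem hx hy
      | smul c x _ hx =>
        rw [Algebra.smul_def, map_mul]
        exact mul_mem ((algebraicClosure L Ω).algebraMap_mem ⟨_, hkL c⟩) hx
    let : Algebra F (algebraicClosure L Ω) := ((algebraMap F Ω).codRestrict _ hF).toAlgebra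
    have : IsScalarTower F (algebraicClosure L Ω) Ω := .of_algebraMap_eq fun _ ↦ rfl
    have : Algebra.IsAlgebraic (algebraicClosure L Ω) Ω := .tower_top (K := F) _
    exact (Algebra.IsAlgebraic.trans L (algebraicClosure L Ω) Ω).isIntegral
  let U : Submodule k F := Submodule.span k ((fun g ↦ (φ g : F)) '' H)
  have hUL (u : F) (hu : u ∈ U) : algebraMap F Ω u ∈ L := by
    induction hu using Submodule.span_induction with
    | mem x hx =>
      obtain ⟨g, hg, rfl⟩ := hx
      exact (hH g).1 hg
    | zero => simp
    | add x y _ _ hx hy => rw [map_add]; exact add_mem hx hy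
    | smul c x _ hx =>
      rw [Algebra.smul_def, map_mul]
      exact mul_mem (hkL c) hx
  have hUH (h : G) (hh : h ∈ H) (u : F) (hu : u ∈ U) : (φ h : F) * u ∈ U := by
    induction hu using Submodule.span_induction with
    | mem x hx =>
      obtain ⟨g, hg, rfl⟩ := hx
      exact Submodule.subset_span ⟨h * g, mul_mem hh hg, by simp⟩
    | zero => simp
    | add x y _ _ hx hy => rw [mul_add]; exact add_mem hx hy
    | smul c x _ hx => rw [mul_smul_comm]; exact Submodule.smul_mem _ _ hx
  obtain ⟨T, hTc, -⟩ := H.exists_isComplement_left 1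
  have hT (g : G) : ∃! t, t ∈ T ∧ t⁻¹ * g ∈ H := by
    obtain ⟨t, ht, hu⟩ := Subgroup.isComplement_iff_existsUnique_inv_mul_mem.1 hTc g
    exact ⟨t, ⟨t.2, ht⟩, fun t' ht' ↦ congr_arg Subtype.val (hu ⟨t', ht'.1⟩ ht'.2)⟩
  refine ⟨H, hHfg, U, hUH, T, hT, fun i ↦ ?_, ?_⟩
  · have htrace (x : Ω) (u : F) (hu : u ∈ U) : Algebra.normalizedTrace L Ω (x * algebraMap F Ω u) =
        (⟨algebraMap F Ω u, hUL u hu⟩ : L) * Algebra.normalizedTrace L Ω x := by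
      have := (Algebra.normalizedTrace L Ω).map_smul ⟨algebraMap F Ω u, hUL u hu⟩ x
      rw [smul_eq_mul] at this
      rw [mul_comm x]
      exact this
    let K : Submodule k F :=
      { carrier := {x | Algebra.normalizedTrace L Ω (algebraMap F Ω ((φ (i : G) : F)⁻¹ * x)) = 0}
        zero_mem' := by simp
        add_mem' := fun {x y} hx hy ↦ by
          simp only [Set.mem_ofPred_eq, mul_add, map_add] at hx hy ⊢
          rw [hx, hy, add_zero]
        smul_mem' := fun c x hx ↦ by
          rw [Set.mem_ofPred_eq] at hx ⊢
          rw [mul_smul_comm, Algebra.smul_def, map_mul]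
          have := (Algebra.normalizedTrace L Ω).map_smul ⟨_, hkL c⟩
            (algebraMap F Ω ((φ (i : G) : F)⁻¹ * x))
          rw [hx, smul_zero] at this
          exact this }
    have hK : ⨆ (j) (_ : j ≠ i), U.map (LinearMap.mulLeft k (φ (j : G) : F)) ≤ K := by
      refine iSup₂_le fun j hj ↦ ?_
      rintro - ⟨u, hu, rfl⟩
      have hij : (ψ ((i : G)⁻¹ * j) : Ω) ∉ L := by
        rw [← hH]
        exact fun h ↦ hj (Subtype.ext ((hT j).unique ⟨j.2, by simp⟩ ⟨i.2, h⟩))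
      have := htrace (ψ ((i : G)⁻¹ * j)) u hu
      rw [htr _ hij, mul_zero, hψφ, ← map_mul, map_mul φ, map_inv, Units.val_mul,
        Units.val_inv_eq_inv_val, mul_assoc] at this
      exact this
    rw [Submodule.disjoint_def]
    rintro - ⟨u, hu, rfl⟩ hx
    have h : Algebra.normalizedTrace L Ω
        (algebraMap F Ω ((φ (i : G) : F)⁻¹ * ((φ (i : G) : F) * u))) = 0 := hK hx
    rw [inv_mul_cancel_left₀ (Units.ne_zero _)] at h
    have hu' := Algebra.normalizedTrace_algebraMap_apply_eq_self L Ω ⟨algebraMap F Ω u, hUL u hu⟩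
    rw [IntermediateField.algebraMap_apply, h] at hu'
    have : algebraMap F Ω u = 0 := congr_arg Subtype.val hu'.symm
    rw [(map_eq_zero _).1 this, map_zero]
  · rw [← top_le_iff, ← hspan, Submodule.span_le]
    rintro - ⟨g, rfl⟩
    obtain ⟨t, ⟨htT, htg⟩, -⟩ := hT g
    refine Submodule.mem_iSup_of_mem ⟨t, htT⟩ ⟨φ (t⁻¹ * g), Submodule.subset_span ⟨_, htg, rfl⟩, ?_⟩
    rw [LinearMap.mulLeft_apply, ← Units.val_mul, ← map_mul, mul_inv_cancel_left]

/-- A simple module over a commutative `k`-algebra `A` is a field `F` on which `A` acts through a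
surjective homomorphism. -/
theorem IsSimpleModule.exists_linearEquiv_field (k : Type*) {A : Type v} (M : Type*) [Field k]
    [CommRing A] [Algebra k A] [AddCommGroup M] [Module A M] [Module k M] [IsScalarTower k A M]
    [IsSimpleModule A M] :
    ∃ (F : Type v) (_ : Field F) (_ : Algebra k F) (π : A →ₐ[k] F) (e : F ≃ₗ[k] M),
      Function.Surjective π ∧ ∀ (a : A) (x : F), e (π a * x) = a • e x := by
  obtain ⟨P, hP, ⟨e⟩⟩ := (isSimpleModule_iff_quot_maximal (R := A) (M := M)).1 inferInstance
  exact ⟨A ⧸ P, Ideal.Quotient.field P, inferInstance, Ideal.Quotient.mkₐ k P,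
    (e.restrictScalars k).symm, Ideal.Quotient.mkₐ_surjective k P, fun a x ↦ e.symm.map_smul a x⟩

/-- Corollary 3.2: over a finitely generated field `k` of characteristic
zero, every faithful irreducible representation of an abelian group `G` of finite rank
with Chernikov torsion subgroup is induced from a representation of a finitely generated
subgroup `H`; i.e. there is a `kH`-submodule `U` of the module `M` with
`M = ⊕_{t ∈ T} Ut` for a transversal `T` to `H` in `G`. -/
theorem faithful_irreducible_representation_induced
    (k : Type*) [Field k] [CharZero k]
    (hk : ∃ S : Set k, S.Finite ∧ IntermediateField.adjoin ℚ S = ⊤)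
    (G : Type*) [CommGroup G]
    -- G has finite rank
    (hrk : ∃ n : ℕ, ∀ H : Subgroup G, H.FG →
      ∃ s : Finset G, s.card ≤ n ∧ Subgroup.closure (s : Set G) = H)
    -- the torsion subgroup t(G) is Chernikov, i.e. satisfies Min on subgroups
    (hmin : WellFoundedLT (Subgroup (CommGroup.torsion G)))
    -- M is the module of an irreducible representation of G over k
    (M : Type*) [AddCommGroup M] [Module (MonoidAlgebra k G) M]
    [Module k M] [IsScalarTower k (MonoidAlgebra k G) M]
    [IsSimpleModule (MonoidAlgebra k G) M]
    -- the representation is faithful: G ∩ (1 + Ann(M)) = 1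
    (hfaith : ∀ g : G, (∀ m : M, MonoidAlgebra.of k G g • m = m) → g = 1) :
    ∃ H : Subgroup G, H.FG ∧
      ∃ U : Submodule k M,
        -- U is a kH-submodule of M
        (∀ h ∈ H, ∀ u ∈ U, MonoidAlgebra.of k G h • u ∈ U) ∧
        ∃ T : Set G,
          -- T is a transversal to H in G
          (∀ g : G, ∃! t, t ∈ T ∧ t⁻¹ * g ∈ H) ∧
          -- M = ⊕_{t ∈ T} Ut
          iSupIndep (fun t : T =>
            U.map (smulLinearMap k (MonoidAlgebra.of k G (t : G)))) ∧
          (⨆ t : T, U.map (smulLinearMap k (MonoidAlgebra.of k G (t : G)))) = ⊤ := by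
  obtain ⟨F, _, _, π, e, hπ, he⟩ :=
    IsSimpleModule.exists_linearEquiv_field k (A := MonoidAlgebra k G) M
  let φ : G →* Fˣ := ((π : MonoidAlgebra k G →* F).comp (MonoidAlgebra.of k G)).toHomUnits
  have hφπ (g : G) : (φ g : F) = π (MonoidAlgebra.of k G g) := rfl
  have hφ : Function.Injective φ := by
    refine (injective_iff_map_eq_one _).2 fun g hg ↦ hfaith g fun m ↦ ?_
    rw [← e.apply_symm_apply m, ← he, ← hφπ, hg, Units.val_one, one_mul]
  have hof : Submodule.span k (Set.range (MonoidAlgebra.of k G)) = ⊤ :=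
    eq_top_iff.2 fun f _ ↦ Submodule.span_mono (Set.image_subset_range _ _)
      (MonoidAlgebra.mem_span_support_coeff f)
  have hspan : Submodule.span k (Set.range fun g ↦ (φ g : F)) = ⊤ := by
    have : (Set.range fun g ↦ (φ g : F)) =
        π.toLinearMap '' Set.range (MonoidAlgebra.of k G) := by
      rw [← Set.range_comp]
      rfl
    rwa [this, ← Submodule.map_span, hof, Submodule.map_top, LinearMap.range_eq_top]
  obtain ⟨H, hH, U, hUH, T, hT, hind, hsup⟩ :=
    Subgroup.exists_iSupIndep_translates hk hrk hmin φ hφ hspan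
  have hmap (g : G) :
      (U.map e.toLinearMap).map (smulLinearMap k (MonoidAlgebra.of k G g)) =
        (U.map (LinearMap.mulLeft k (φ g : F))).map e.toLinearMap := by
    rw [← Submodule.map_comp, ← Submodule.map_comp]
    congr 1
    ext x
    exact (he _ x).symm
  refine ⟨H, hH, U.map e.toLinearMap, ?_, T, hT, ?_, ?_⟩
  · rintro h hh - ⟨u, hu, rfl⟩
    exact ⟨_, hUH h hh u hu, he _ u⟩
  · simp_rw [hmap]
    exact hind.map_orderIso (Submodule.orderIsoMapComap e)
  · simp_rw [hmap]
    rw [← Submodule.map_iSup, hsup, Submodule.map_top, LinearEquiv.range]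
end
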